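/- arXiv:nlin/0306047 — 2 statements merged into one kernel-verified Lean document; each statement's English description precedes it below -/
import Mathlib

section
/- Existence via characteristics for the additive kernel: Let ν₀ be a positive Radon measure on (0,∞) with ∫ x ν₀(dx) = 1, and set φ₀(s) = ∫ (1−e^{−sx}) ν₀(dx). Then: (i) for every t ≥ 0 and s > 0 the equation s = σ − (1−e^{−t})φ₀(σ) has a unique solution σ = σ(t,s) > 0, and s ↦ dσ/ds is completely monotone; (ii) u(t,s) := e^{−t} u₀(σ(t,s)) dσ/ds, where u₀ = φ₀′, is completely monotone in s with lim_{s→0⁺} u(t,s) = 1; hence there is a family of positive Radon measures (ν_t)_{t≥0} on (0,∞) with ∫ e^{−sx} x ν_t(dx) = u(t,s), ∫ x ν_t(dx) = 1 for all t, and t ↦ x ν_t(dx) weakly continuous. -/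
/-!
Existence via characteristics for the additive kernel K = x + y
(Menon–Pego, Lemma 2.9).
-/

open MeasureTheory Filter Topology Set Real

noncomputable section

/-- Complete monotonicity of g on (0,∞):
g is infinitely differentiable with (−1)ⁿ g⁽ⁿ⁾ ≥ 0 on (0,∞). -/
def CompletelyMonotoneOn (g : ℝ → ℝ) : Prop :=
  (∀ n : ℕ, DifferentiableOn ℝ (iteratedDeriv n g) (Set.Ioi 0)) ∧
  (∀ n : ℕ, ∀ s : ℝ, 0 < s → 0 ≤ (-1 : ℝ) ^ n * iteratedDeriv n g s)

/-- Complete monotonicity up to order `n`. -/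
def NCM : ℕ → (ℝ → ℝ) → Prop
  | 0, f => ∀ s : ℝ, 0 < s → 0 ≤ f s
  | n + 1, f => (∀ s : ℝ, 0 < s → 0 ≤ f s) ∧
      ∃ g : ℝ → ℝ, (∀ s : ℝ, 0 < s → HasDerivAt f (-(g s)) s) ∧ NCM n g

theorem NCM.nonneg {n : ℕ} {f : ℝ → ℝ} (h : NCM n f) : ∀ s : ℝ, 0 < s → 0 ≤ f s := by
  cases n with
  | zero => exact h
  | succ n => exact h.1

theorem NCM.pred {n : ℕ} : ∀ {f : ℝ → ℝ}, NCM (n + 1) f → NCM n f := by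
  induction n with
  | zero => intro f h; exact h.1
  | succ n ih =>
    rintro f ⟨h1, g, hg, hn⟩
    exact ⟨h1, g, hg, ih hn⟩

theorem NCM.congr {n : ℕ} {f g : ℝ → ℝ} (h : NCM n f) (hfg : ∀ s : ℝ, 0 < s → g s = f s) :
    NCM n g := by
  cases n with
  | zero => intro s hs; rw [hfg s hs]; exact h s hs
  | succ n =>
    obtain ⟨h1, k, hk, hn⟩ := h
    refine ⟨fun s hs => by rw [hfg s hs]; exact h1 s hs, k, fun s hs => ?_, hn⟩
    refine (hk s hs).congr_of_eventuallyEq ?_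
    filter_upwards [Ioi_mem_nhds hs] with y hy using hfg y hy

theorem NCM.add {n : ℕ} : ∀ {f g : ℝ → ℝ}, NCM n f → NCM n g → NCM n (fun s => f s + g s) := by
  induction n with
  | zero => intro f g hf hg s hs; exact add_nonneg (hf s hs) (hg s hs)
  | succ n ih =>
    rintro f g ⟨hf, f', hf', hfn⟩ ⟨hg, g', hg', hgn⟩
    refine ⟨fun s hs => add_nonneg (hf s hs) (hg s hs), fun s => f' s + g' s, fun s hs => ?_,
      ih hfn hgn⟩
    exact ((hf' s hs).add (hg' s hs)).congr_deriv (by ring)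

theorem NCM.mul {n : ℕ} : ∀ {f g : ℝ → ℝ}, NCM n f → NCM n g → NCM n (fun s => f s * g s) := by
  induction n with
  | zero => intro f g hf hg s hs; exact mul_nonneg (hf s hs) (hg s hs)
  | succ n ih =>
    intro f g hf0 hg0
    obtain ⟨hf, f', hf', hfn⟩ := hf0
    obtain ⟨hg, g', hg', hgn⟩ := hg0
    have hfp : NCM n f := NCM.pred ⟨hf, f', hf', hfn⟩
    have hgp : NCM n g := NCM.pred ⟨hg, g', hg', hgn⟩
    refine ⟨fun s hs => mul_nonneg (hf s hs) (hg s hs), fun s => f' s * g s + f s * g' s,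
      fun s hs => ?_, (ih hfn hgp).add (ih hfp hgn)⟩
    exact ((hf' s hs).mul (hg' s hs)).congr_deriv (by ring)

theorem NCM.const {n : ℕ} : ∀ {c : ℝ}, 0 ≤ c → NCM n (fun _ => c) := by
  induction n with
  | zero => intro c hc s _; exact hc
  | succ n ih =>
    intro c hc
    refine ⟨fun s _ => hc, fun _ => 0, fun s _ => ?_, ih le_rfl⟩
    simpa using hasDerivAt_const s c

theorem NCM.comp {n : ℕ} {σ p : ℝ → ℝ} (hσ : ∀ s : ℝ, 0 < s → 0 < σ s)
    (hp : ∀ s : ℝ, 0 < s → HasDerivAt σ (p s) s) (hpn : NCM n p) :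
    ∀ {f : ℝ → ℝ}, NCM (n + 1) f → NCM (n + 1) (fun s => f (σ s)) := by
  induction n with
  | zero =>
    rintro f ⟨hf, f', hf', hfn⟩
    refine ⟨fun s hs => hf _ (hσ s hs), fun s => f' (σ s) * p s, fun s hs => ?_,
      fun s hs => mul_nonneg (hfn _ (hσ s hs)) (hpn s hs)⟩
    exact ((hf' _ (hσ s hs)).comp s (hp s hs)).congr_deriv (by ring)
  | succ n ih =>
    rintro f ⟨hf, f', hf', hfn⟩
    refine ⟨fun s hs => hf _ (hσ s hs), fun s => f' (σ s) * p s, fun s hs => ?_,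
      (ih hpn.pred hfn).mul hpn⟩
    exact ((hf' _ (hσ s hs)).comp s (hp s hs)).congr_deriv (by ring)

theorem NCM.iter {n : ℕ} : ∀ {f : ℝ → ℝ}, NCM (n + 1) f → ∀ s : ℝ, 0 < s →
    0 ≤ (-1 : ℝ) ^ n * iteratedDeriv n f s ∧ DifferentiableAt ℝ (iteratedDeriv n f) s := by
  induction n with
  | zero =>
    rintro f ⟨hf, f', hf', -⟩ s hs
    simpa using ⟨hf s hs, (hf' s hs).differentiableAt⟩
  | succ n ih =>
    rintro f ⟨hf, f', hf', hfn⟩ s hs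
    have key : ∀ y : ℝ, 0 < y → iteratedDeriv (n + 1) f y = -(iteratedDeriv n f' y) := by
      intro y hy
      rw [iteratedDeriv_succ', ← iteratedDeriv_neg]
      apply Filter.EventuallyEq.iteratedDeriv_eq
      filter_upwards [Ioi_mem_nhds hy] with z hz using (hf' z hz).deriv
    obtain ⟨h1, h2⟩ := ih hfn s hs
    refine ⟨by rw [key s hs, pow_succ]; linarith, ?_⟩
    refine h2.neg.congr_of_eventuallyEq ?_
    filter_upwards [Ioi_mem_nhds hs] with z hz using key z hz

theorem NCM.cm {f : ℝ → ℝ} (h : ∀ n, NCM n f) : CompletelyMonotoneOn f :=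
  ⟨fun n s hs => ((h (n + 1)).iter s hs).2.differentiableWithinAt,
    fun n s hs => ((h (n + 1)).iter s hs).1⟩

/-- Taylor remainder. -/
def TR (D : ℕ → ℝ → ℝ) (a : ℝ) (k N : ℕ) (h : ℝ) : ℝ :=
  D k (a - h) - ∑ j ∈ Finset.range N, D (k + j) a * h ^ j / (j.factorial : ℝ)

structure DSeq (D : ℕ → ℝ → ℝ) : Prop where
  nonneg : ∀ k s, 0 < s → 0 ≤ D k s
  deriv : ∀ k s, 0 < s → HasDerivAt (D k) (-(D (k + 1) s)) s

theorem TR_deriv {D : ℕ → ℝ → ℝ} (hD : DSeq D) {a : ℝ} (k N : ℕ) {h : ℝ} (hh : h < a) :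
    HasDerivAt (TR D a k N) (TR D a (k + 1) (N - 1) h) h := by
  have h1 : HasDerivAt (fun h => D k (a - h)) (D (k + 1) (a - h)) h := by
    have := (hD.deriv k (a - h) (by linarith)).comp h ((hasDerivAt_id h).const_sub a)
    exact this.congr_deriv (by simp)
  have h2 : HasDerivAt (fun h : ℝ => ∑ j ∈ Finset.range N, D (k + j) a * h ^ j / (j.factorial : ℝ))
      (∑ j ∈ Finset.range (N - 1), D (k + 1 + j) a * h ^ j / (j.factorial : ℝ)) h := by
    have h3 : HasDerivAt (fun h : ℝ => ∑ j ∈ Finset.range N, D (k + j) a * h ^ j / (j.factorial : ℝ))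
      (∑ j ∈ Finset.range N, D (k + j) a * (j * h ^ (j - 1)) / (j.factorial : ℝ)) h := by
      apply HasDerivAt.fun_sum
      intro j _
      exact (((hasDerivAt_pow j h)).const_mul _).div_const _
    convert h3 using 1
    cases N with
    | zero => simp
    | succ N =>
      rw [Finset.sum_range_succ']
      simp only [Nat.add_sub_cancel, Nat.cast_zero, zero_mul, mul_zero, zero_div, add_zero]
      refine Finset.sum_congr rfl fun j _ => ?_
      rw [Nat.factorial_succ, show k + 1 + j = k + (j + 1) by ring]
      push_cast
      have : (j.factorial : ℝ) ≠ 0 := by positivity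
      field_simp
  exact h1.sub h2

theorem TR_zero {D : ℕ → ℝ → ℝ} {a : ℝ} (k N : ℕ) : TR D a k (N + 1) 0 = 0 := by
  simp [TR, Finset.sum_range_succ']

theorem mono_aux {F F' : ℝ → ℝ} {a h : ℝ} (hF : ∀ x < a, HasDerivAt F (F' x) x)
    (hF' : ∀ x, 0 ≤ x → x < a → 0 ≤ F' x) (h0 : F 0 = 0) (hh : 0 ≤ h) (hha : h < a) : 0 ≤ F h := by
  rw [← h0]
  refine monotoneOn_of_deriv_nonneg (convex_Ico 0 a) ?_ ?_ ?_ ⟨le_rfl, by linarith⟩ ⟨hh, hha⟩ hh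
  · exact fun x hx => (hF x hx.2).continuousAt.continuousWithinAt
  · rw [interior_Ico]
    exact fun x hx => (hF x hx.2).differentiableAt.differentiableWithinAt
  · rw [interior_Ico]
    intro x hx
    rw [(hF x hx.2).deriv]
    exact hF' x hx.1.le hx.2

theorem TR_nonneg {D : ℕ → ℝ → ℝ} (hD : DSeq D) {a : ℝ} (N : ℕ) : ∀ (k : ℕ) (h : ℝ),
    0 ≤ h → h < a → 0 ≤ TR D a k N h := by
  induction N with
  | zero => intro k h h0 ha; simpa [TR] using hD.nonneg k (a - h) (by linarith)
  | succ N ih =>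
    intro k h h0 ha
    exact mono_aux (fun x hx => TR_deriv hD k (N + 1) hx) (fun x hx hxa => ih (k + 1) x hx hxa)
      (TR_zero k N) h0 ha

theorem TR_slope {D : ℕ → ℝ → ℝ} (hD : DSeq D) {a : ℝ} (N : ℕ) : ∀ (k : ℕ) (h : ℝ),
    0 ≤ h → h < a → 0 ≤ h * TR D a (k + 1) (N - 1) h - N * TR D a k N h := by
  induction N with
  | zero =>
    intro k h h0 ha
    simpa using mul_nonneg h0 (TR_nonneg hD 0 (k + 1) h h0 ha)
  | succ N ih =>
    intro k h h0 ha
    refine mono_aux (F := fun h => h * TR D a (k + 1) N h - ((N + 1 : ℕ) : ℝ) * TR D a k (N + 1) h)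
      (F' := fun h => h * TR D a (k + 1 + 1) (N - 1) h - N * TR D a (k + 1) N h)
      (fun x hx => ?_) (fun x hx hxa => ih (k + 1) x hx hxa) (by simp [TR_zero]) h0 ha
    refine (((hasDerivAt_id x).mul (TR_deriv hD (k + 1) N hx)).sub
      ((TR_deriv hD k (N + 1) hx).const_mul ((N + 1 : ℕ) : ℝ))).congr_deriv ?_
    simp
    ring

theorem TR_bound {D : ℕ → ℝ → ℝ} (hD : DSeq D) {a h H : ℝ} (N : ℕ) (k : ℕ)
    (h0 : 0 < h) (hH : h ≤ H) (ha : H < a) :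
    TR D a k N h ≤ (h / H) ^ N * TR D a k N H := by
  have hm : MonotoneOn (fun x => TR D a k N x / x ^ N) (Ioo 0 a) := by
    have hd : ∀ x ∈ Ioo 0 a, HasDerivAt (fun x => TR D a k N x / x ^ N)
        ((TR D a (k + 1) (N - 1) x * x ^ N - TR D a k N x * (N * x ^ (N - 1))) / (x ^ N) ^ 2) x := by
      intro x hx
      exact (TR_deriv hD k N hx.2).div (hasDerivAt_pow N x) (pow_pos hx.1 N).ne'
    refine monotoneOn_of_deriv_nonneg (convex_Ioo 0 a) ?_ ?_ ?_
    · exact fun x hx => (hd x hx).continuousAt.continuousWithinAt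
    · rw [interior_Ioo]
      exact fun x hx => (hd x hx).differentiableAt.differentiableWithinAt
    · rw [interior_Ioo]
      intro x hx
      rw [(hd x hx).deriv]
      have hx0 : 0 < x := hx.1
      apply div_nonneg _ (by positivity)
      have := TR_slope hD N k x hx.1.le hx.2
      cases N with
      | zero => simpa using TR_nonneg hD 0 (k + 1) x hx.1.le hx.2
      | succ N =>
        have := mul_nonneg (pow_pos hx0 N).le this
        simp only [Nat.add_sub_cancel, pow_succ] at this ⊢
        linarith
  have := hm ⟨h0, by linarith⟩ ⟨h0.trans_le hH, ha⟩ hH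
  simp only at this
  have hH0 : 0 < H := h0.trans_le hH
  rw [div_le_div_iff₀ (by positivity) (by positivity)] at this
  rw [div_pow, div_mul_eq_mul_div, le_div_iff₀ (by positivity)]
  linarith

theorem taylor_hasSum {D : ℕ → ℝ → ℝ} (hD : DSeq D) {a h : ℝ} (h0 : 0 < h) (ha : h < a) :
    HasSum (fun j : ℕ => D j a * h ^ j / (j.factorial : ℝ)) (D 0 (a - h)) := by
  have hnn : ∀ j : ℕ, 0 ≤ D j a * h ^ j / (j.factorial : ℝ) := fun j =>
    div_nonneg (mul_nonneg (hD.nonneg j a (by linarith)) (by positivity)) (by positivity)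
  rw [hasSum_iff_tendsto_nat_of_nonneg hnn]
  obtain ⟨H, hhH, hHa⟩ := exists_between ha
  have hH0 : 0 < H := h0.trans hhH
  have hR : Tendsto (fun N => TR D a 0 N h) atTop (𝓝 0) := by
    have hb : ∀ N, TR D a 0 N h ≤ (h / H) ^ N * D 0 (a - H) := by
      intro N
      refine (TR_bound hD N 0 h0 hhH.le hHa).trans ?_
      apply mul_le_mul_of_nonneg_left _ (by positivity)
      rw [TR, sub_le_self_iff]
      exact Finset.sum_nonneg fun j _ =>
        div_nonneg (mul_nonneg (hD.nonneg _ a (by linarith)) (by positivity)) (by positivity)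
    refine squeeze_zero (fun N => TR_nonneg hD N 0 h h0.le ha) hb ?_
    have := (tendsto_pow_atTop_nhds_zero_of_lt_one (r := h / H) (by positivity)
      (by rw [div_lt_one hH0]; exact hhH)).mul_const (D 0 (a - H))
    simpa using this
  have := (tendsto_const_nhds (x := D 0 (a - h))).sub hR
  simpa [TR] using this

theorem taylor_hasSum_end {D : ℕ → ℝ → ℝ} (hD : DSeq D) {a : ℝ} (ha : 0 < a)
    (h1 : Tendsto (D 0) (𝓝[>] 0) (𝓝 1)) :
    HasSum (fun j : ℕ => D j a * a ^ j / (j.factorial : ℝ)) 1 := by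
  have hnn : ∀ j : ℕ, 0 ≤ D j a / (j.factorial : ℝ) := fun j =>
    div_nonneg (hD.nonneg j a ha) (by positivity)
  have hnn' : ∀ j : ℕ, 0 ≤ D j a * a ^ j / (j.factorial : ℝ) := fun j =>
    div_nonneg (mul_nonneg (hD.nonneg j a (by linarith)) (by positivity)) (by positivity)
  have hlim : Tendsto (fun h => D 0 (a - h)) (𝓝[<] a) (𝓝 1) := by
    refine h1.comp (tendsto_nhdsWithin_iff.2 ⟨?_, ?_⟩)
    · have : Tendsto (fun h => a - h) (𝓝 a) (𝓝 (a - a)) := (by fun_prop : Continuous fun h => a - h).tendsto a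
      rw [sub_self] at this
      exact this.mono_left nhdsWithin_le_nhds
    · filter_upwards [self_mem_nhdsWithin] with h hh
      simpa using hh
  have hev : ∀ᶠ h in 𝓝[<] a, 0 < h ∧ h < a := by
    filter_upwards [self_mem_nhdsWithin, nhdsWithin_le_nhds (Ioi_mem_nhds ha)] with h h1 h2
    exact ⟨h2, h1⟩
  have hpart : ∀ s : Finset ℕ, ∑ j ∈ s, D j a * a ^ j / (j.factorial : ℝ) ≤ 1 := by
    intro s
    have hc : Tendsto (fun h : ℝ => ∑ j ∈ s, D j a * h ^ j / (j.factorial : ℝ)) (𝓝[<] a)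
        (𝓝 (∑ j ∈ s, D j a * a ^ j / (j.factorial : ℝ))) := by
      have : Continuous (fun h : ℝ => ∑ j ∈ s, D j a * h ^ j / (j.factorial : ℝ)) := by fun_prop
      exact (this.tendsto a).mono_left nhdsWithin_le_nhds
    refine le_of_tendsto_of_tendsto hc hlim ?_
    filter_upwards [hev] with h hh
    refine sum_le_hasSum s (fun j _ => ?_) (taylor_hasSum hD hh.1 hh.2)
    have := hh.1
    exact div_nonneg (mul_nonneg (hD.nonneg j a (by linarith)) (by positivity)) (by positivity)
  have hs : Summable (fun j : ℕ => D j a * a ^ j / (j.factorial : ℝ)) :=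
    summable_of_sum_le hnn' hpart
  have hle : ∑' j : ℕ, D j a * a ^ j / (j.factorial : ℝ) ≤ 1 := hs.tsum_le_of_sum_le hpart
  have hge : 1 ≤ ∑' j : ℕ, D j a * a ^ j / (j.factorial : ℝ) := by
    refine le_of_tendsto hlim ?_
    filter_upwards [hev] with h hh
    rw [← (taylor_hasSum hD hh.1 hh.2).tsum_eq]
    refine (taylor_hasSum hD hh.1 hh.2).summable.tsum_le_tsum (fun j => ?_) hs
    have := hD.nonneg j a ha
    have h3 := hh.1.le
    have h4 := hh.2.le
    gcongr
  rw [← le_antisymm hle hge]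
  exact hs.hasSum

theorem approx_arg {s : ℝ} :
    Tendsto (fun n : ℕ => ((n : ℝ) + 1) - ((n : ℝ) + 1) * Real.exp (-(s / ((n : ℝ) + 1)))) atTop
      (𝓝 s) := by
  have h1 : HasDerivAt (fun x : ℝ => -Real.exp (-(s * x))) s 0 := by
    have h2 : HasDerivAt (fun x : ℝ => -(s * x)) (-s) 0 := by
      exact ((hasDerivAt_id (0 : ℝ)).const_mul s).neg.congr_deriv (by simp)
    refine h2.exp.neg.congr_deriv ?_
    simp
  rw [hasDerivAt_iff_tendsto_slope_zero] at h1
  have h3 : Tendsto (fun n : ℕ => 1 / ((n : ℝ) + 1)) atTop (𝓝[≠] 0) := by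
    refine tendsto_nhdsWithin_iff.2 ⟨tendsto_one_div_add_atTop_nhds_zero_nat, ?_⟩
    exact Eventually.of_forall fun n => by
      have : (0 : ℝ) < 1 / ((n : ℝ) + 1) := by positivity
      exact this.ne'
  refine (h1.comp h3).congr fun n => ?_
  simp only [Function.comp, zero_add, mul_zero, neg_zero, Real.exp_zero, smul_eq_mul, div_eq_mul_inv,
    one_mul, inv_inv]
  ring

/-- Discrete approximations in Feller's proof of Bernstein's theorem. -/
theorem bernstein_approx {D : ℕ → ℝ → ℝ} (hD : DSeq D) {a : ℝ} (ha : 0 < a)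
    (h1 : Tendsto (D 0) (𝓝[>] 0) (𝓝 1)) :
    ∃ P : ProbabilityMeasure (Set.Icc (0 : ℝ) 1), ∀ s : ℝ, 0 < s →
      ∫ y, (y : ℝ) ^ s ∂(P : Measure (Set.Icc (0 : ℝ) 1)) = D 0 (a - a * Real.exp (-(s / a))) := by
  have hnn : ∀ j : ℕ, 0 ≤ D j a * a ^ j / (j.factorial : ℝ) := fun j =>
    div_nonneg (mul_nonneg (hD.nonneg j a (by linarith)) (by positivity)) (by positivity)
  have hsum := taylor_hasSum_end hD ha h1
  have hsumE : HasSum (fun j : ℕ => ENNReal.ofReal (D j a * a ^ j / (j.factorial : ℝ))) 1 := by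
    have h2 := ENNReal.ofReal_tsum_of_nonneg hnn hsum.summable
    rw [hsum.tsum_eq, ENNReal.ofReal_one] at h2
    rw [h2]
    exact ENNReal.summable.hasSum
  let p : PMF ℕ := ⟨_, hsumE⟩
  let e : ℕ → Set.Icc (0 : ℝ) 1 := fun j => ⟨Real.exp (-(j / a)), (Real.exp_pos _).le, by
    rw [Real.exp_le_one_iff, neg_nonpos]; positivity⟩
  have he : Measurable e := measurable_of_countable e
  have hP : IsProbabilityMeasure (p.toMeasure.map e) :=
    Measure.isProbabilityMeasure_map he.aemeasurable
  refine ⟨⟨p.toMeasure.map e, hP⟩, fun s hs => ?_⟩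
  have hcont : Continuous (fun y : Set.Icc (0 : ℝ) 1 => (y : ℝ) ^ s) :=
    (Real.continuous_rpow_const hs.le).comp continuous_subtype_val
  rw [ProbabilityMeasure.coe_mk, integral_map he.aemeasurable hcont.aestronglyMeasurable]
  rw [PMF.integral_eq_tsum]
  · have ht := taylor_hasSum hD (a := a) (h := a * Real.exp (-(s / a))) (by positivity) (by
      have : Real.exp (-(s / a)) < 1 := by
        rw [Real.exp_lt_one_iff, neg_lt_zero]; positivity
      nlinarith)
    rw [← ht.tsum_eq]
    refine tsum_congr fun j => ?_
    have hpj : (p j).toReal = D j a * a ^ j / (j.factorial : ℝ) := ENNReal.toReal_ofReal (hnn j)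
    have hej : ((e j : ℝ)) ^ s = Real.exp (-(s / a)) ^ j := by
      change Real.exp (-(j / a)) ^ s = _
      rw [← Real.exp_mul, ← Real.exp_nat_mul]
      congr 1
      ring
    rw [hpj, hej, smul_eq_mul, mul_pow]
    ring
  · refine Integrable.of_bound (measurable_of_countable _).aestronglyMeasurable 1 ?_
    refine Eventually.of_forall fun j => ?_
    rw [Real.norm_of_nonneg (Real.rpow_nonneg (e j).2.1 _)]
    exact Real.rpow_le_one (e j).2.1 (e j).2.2 hs.le

theorem bernstein_Icc {D : ℕ → ℝ → ℝ} (hD : DSeq D)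
    (h1 : Tendsto (D 0) (𝓝[>] 0) (𝓝 1)) :
    ∃ P : ProbabilityMeasure (Set.Icc (0 : ℝ) 1), ∀ s : ℝ, 0 < s →
      ∫ y, (y : ℝ) ^ s ∂(P : Measure (Set.Icc (0 : ℝ) 1)) = D 0 s := by
  choose P hP using fun n : ℕ => bernstein_approx hD (a := (n : ℝ) + 1) (by positivity) h1
  let 𝒰 : Ultrafilter ℕ := Ultrafilter.of atTop
  obtain ⟨Q, -, hQ⟩ := isCompact_univ.ultrafilter_le_nhds (𝒰.map P) (by simp)
  refine ⟨Q, fun s hs => ?_⟩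
  have hcont : Continuous (fun y : Set.Icc (0 : ℝ) 1 => (y : ℝ) ^ s) :=
    (Real.continuous_rpow_const hs.le).comp continuous_subtype_val
  have hT : Tendsto P 𝒰 (𝓝 Q) := hQ
  have h2 := ProbabilityMeasure.tendsto_iff_forall_integral_tendsto.1 hT
    (BoundedContinuousFunction.mkOfCompact ⟨_, hcont⟩)
  have h3 : Tendsto (fun n : ℕ => D 0 (((n : ℝ) + 1) - ((n : ℝ) + 1) *
      Real.exp (-(s / ((n : ℝ) + 1))))) 𝒰 (𝓝 (D 0 s)) :=
    ((hD.deriv 0 s hs).continuousAt.tendsto.comp approx_arg).mono_left (Ultrafilter.of_le _)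
  refine tendsto_nhds_unique h2 (h3.congr fun n => ?_)
  rw [← hP n s hs]
  rfl

theorem bernstein_thm {D : ℕ → ℝ → ℝ} (hD : DSeq D)
    (h1 : Tendsto (D 0) (𝓝[>] 0) (𝓝 1)) (hinf : Tendsto (D 0) atTop (𝓝 0)) :
    ∃ ρ : Measure ℝ, IsProbabilityMeasure ρ ∧ ρ (Set.Iic 0) = 0 ∧
      ∀ s : ℝ, 0 < s → ∫ x, Real.exp (-(s * x)) ∂ρ = D 0 s := by
  obtain ⟨P, hP⟩ := bernstein_Icc hD h1
  let e : Set.Icc (0 : ℝ) 1 → ℝ := fun y => -Real.log y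
  have he : Measurable e := (Real.measurable_log.comp measurable_subtype_coe).neg
  -- the part of the measure away from the endpoint `0`
  let B : Set (Set.Icc (0 : ℝ) 1) := {y | (y : ℝ) ≠ 0}
  have hB : MeasurableSet B := (measurable_subtype_coe (measurableSet_singleton (0 : ℝ))).compl
  let P' : Measure (Set.Icc (0 : ℝ) 1) := (P : Measure (Set.Icc (0 : ℝ) 1))
  let ρ : Measure ℝ := (P'.restrict B).map e
  have hfin : IsFiniteMeasure ρ := by infer_instance
  have hnn : ∀ᵐ x ∂ρ, 0 ≤ x := by
    rw [ae_map_iff he.aemeasurable measurableSet_Ici]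
    exact Eventually.of_forall fun y => by
      simpa [e] using Real.log_nonpos y.2.1 y.2.2
  have hL : ∀ s : ℝ, 0 < s → ∫ x, Real.exp (-(s * x)) ∂ρ = D 0 s := by
    intro s hs
    rw [integral_map he.aemeasurable (by fun_prop), ← hP s hs]
    rw [← integral_indicator hB]
    refine integral_congr_ae (Eventually.of_forall fun y => ?_)
    by_cases hy : (y : ℝ) = 0
    · have : y ∉ B := fun h => h hy
      simp only [Set.indicator_of_notMem this, hy, Real.zero_rpow hs.ne']
    · have : y ∈ B := hy
      simp only [Set.indicator_of_mem this]
      have hy0 : 0 < (y : ℝ) := lt_of_le_of_ne y.2.1 (Ne.symm hy)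
      rw [Real.rpow_def_of_pos hy0]
      simp [e, mul_comm]
  -- mass one
  have hmass : Tendsto (fun s : ℝ => ∫ x, Real.exp (-(s * x)) ∂ρ) (𝓝[>] 0) (𝓝 (∫ _x, (1 : ℝ) ∂ρ)) := by
    refine tendsto_integral_filter_of_dominated_convergence (fun _ => 1) ?_ ?_ (integrable_const _) ?_
    · exact Eventually.of_forall fun s => by fun_prop
    · filter_upwards [self_mem_nhdsWithin] with s hs
      filter_upwards [hnn] with x hx
      rw [Real.norm_of_nonneg (Real.exp_pos _).le, Real.exp_le_one_iff]
      have := mul_nonneg (le_of_lt (Set.mem_Ioi.1 hs)) hx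
      linarith
    · refine Eventually.of_forall fun x => ?_
      have : Continuous (fun s : ℝ => Real.exp (-(s * x))) := by fun_prop
      have := this.tendsto 0
      simp only [zero_mul, neg_zero, Real.exp_zero] at this
      exact this.mono_left nhdsWithin_le_nhds
  have hone : ρ.real Set.univ = 1 := by
    have h2 : Tendsto (fun s : ℝ => ∫ x, Real.exp (-(s * x)) ∂ρ) (𝓝[>] 0) (𝓝 1) := by
      refine h1.congr' ?_
      filter_upwards [self_mem_nhdsWithin] with s hs using (hL s hs).symm
    have := tendsto_nhds_unique hmass h2
    simpa using this
  have hprob : IsProbabilityMeasure ρ := by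
    constructor
    rw [← ENNReal.ofReal_one, ← hone, ofReal_measureReal]
  refine ⟨ρ, hprob, ?_, hL⟩
  have hlim : Tendsto (fun s : ℝ => ∫ x, Real.exp (-(s * x)) ∂ρ) atTop
      (𝓝 (∫ x, (Set.Iic (0 : ℝ)).indicator (fun _ => (1 : ℝ)) x ∂ρ)) := by
    refine tendsto_integral_filter_of_dominated_convergence (fun _ => 1) ?_ ?_ (integrable_const _) ?_
    · exact Eventually.of_forall fun s => by fun_prop
    · filter_upwards [eventually_gt_atTop 0] with s hs
      filter_upwards [hnn] with x hx
      rw [Real.norm_of_nonneg (Real.exp_pos _).le, Real.exp_le_one_iff]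
      have := mul_nonneg hs.le hx
      linarith
    · filter_upwards [hnn] with x hx
      rcases hx.eq_or_lt with rfl | hx
      · simp
      · rw [Set.indicator_of_notMem (by simpa using hx)]
        exact Real.tendsto_exp_neg_atTop_nhds_zero.comp (tendsto_id.atTop_mul_const hx)
  have h2 : Tendsto (fun s : ℝ => ∫ x, Real.exp (-(s * x)) ∂ρ) atTop (𝓝 0) := by
    refine hinf.congr' ?_
    filter_upwards [eventually_gt_atTop 0] with s hs using (hL s hs).symm
  have h3 := tendsto_nhds_unique hlim h2
  rw [integral_indicator measurableSet_Iic] at h3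
  simpa [Measure.real, ENNReal.toReal_eq_zero_iff] using h3

/-- Convergence of Laplace transforms implies weak convergence against test functions. -/
theorem weak_of_laplace {ι : Type*} {l : Filter ι} {ρ : ι → Measure ℝ} {ρ' : Measure ℝ}
    (hρ : ∀ᶠ i in l, IsProbabilityMeasure (ρ i) ∧ (ρ i) (Set.Iic 0) = 0)
    [IsProbabilityMeasure ρ'] (hρ' : ρ' (Set.Iic 0) = 0)
    (hL : ∀ s : ℝ, 0 < s → Tendsto (fun i => ∫ x, Real.exp (-(s * x)) ∂(ρ i)) l
      (𝓝 (∫ x, Real.exp (-(s * x)) ∂ρ')))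
    {f : ℝ → ℝ} (hf : Continuous f) (hfc : HasCompactSupport f) (hfs : tsupport f ⊆ Set.Ioi 0) :
    Tendsto (fun i => ∫ x, f x ∂(ρ i)) l (𝓝 (∫ x, f x ∂ρ')) := by
  have hf0 : f 0 = 0 := image_eq_zero_of_notMem_tsupport fun h => lt_irrefl (0 : ℝ) (hfs h)
  have hF : Continuous (fun y : ℝ => f (-Real.log y)) := by
    rw [continuous_iff_continuousAt]
    intro y
    by_cases hy : y = 0
    · subst hy
      rw [← continuousWithinAt_compl_self]
      have h1 : Tendsto f atTop (𝓝 0) := by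
        have h2 : Tendsto f (cocompact ℝ) (𝓝 0) := hfc.is_zero_at_infty
        exact h2.mono_left atTop_le_cocompact
      have h3 : Tendsto (fun y : ℝ => f (-Real.log y)) (𝓝[≠] 0) (𝓝 0) :=
        h1.comp (tendsto_neg_atBot_atTop.comp Real.tendsto_log_nhdsNE_zero)
      simpa [ContinuousWithinAt, hf0] using h3
    · exact (hf.continuousAt).comp (Real.continuousAt_log hy).neg
  have key : ∀ (p : Polynomial ℝ) (m : Measure ℝ), IsProbabilityMeasure m → m (Set.Iic 0) = 0 →
      Integrable (fun x => p.eval (Real.exp (-x))) m ∧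
      ∫ x, p.eval (Real.exp (-x)) ∂m =
      ∑ k ∈ Finset.range (p.natDegree + 1), p.coeff k * ∫ x, Real.exp (-((k : ℝ) * x)) ∂m := by
    intro p m hm hm0
    have hpos : ∀ᵐ x ∂m, 0 < x := by
      rw [ae_iff]; simpa [Set.Iic] using! hm0
    have hi : ∀ k : ℕ, Integrable (fun x : ℝ => p.coeff k * Real.exp (-((k : ℝ) * x))) m := by
      intro k
      refine Integrable.const_mul ?_ _
      refine Integrable.of_bound (by fun_prop) 1 ?_
      filter_upwards [hpos] with x hx
      rw [Real.norm_of_nonneg (Real.exp_pos _).le, Real.exp_le_one_iff]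
      have : 0 ≤ (k : ℝ) * x := by positivity
      linarith
    have hrw : (fun x : ℝ => p.eval (Real.exp (-x))) = fun x =>
        ∑ k ∈ Finset.range (p.natDegree + 1), p.coeff k * Real.exp (-((k : ℝ) * x)) := by
      ext x
      rw [Polynomial.eval_eq_sum_range]
      refine Finset.sum_congr rfl fun k _ => ?_
      rw [← Real.exp_nat_mul]
      ring_nf
    rw [hrw]
    refine ⟨integrable_finsetSum _ fun k _ => hi k, ?_⟩
    rw [integral_finsetSum _ fun k _ => hi k]
    simp only [integral_const_mul]
  have close : ∀ (p : Polynomial ℝ) (ε : ℝ),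
      (∀ y ∈ Set.Icc (0 : ℝ) 1, |p.eval y - f (-Real.log y)| < ε) →
      ∀ m : Measure ℝ, IsProbabilityMeasure m → m (Set.Iic 0) = 0 →
      |∫ x, p.eval (Real.exp (-x)) ∂m - ∫ x, f x ∂m| ≤ ε := by
    intro p ε hp m hm hm0
    have hpos : ∀ᵐ x ∂m, 0 < x := by
      rw [ae_iff]; simpa [Set.Iic] using! hm0
    rw [← integral_sub (key p m hm hm0).1 (hf.integrable_of_hasCompactSupport hfc)]
    have h5 : ∀ᵐ x ∂m, ‖p.eval (Real.exp (-x)) - f x‖ ≤ ε := by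
      filter_upwards [hpos] with x hx
      have := hp (Real.exp (-x)) ⟨(Real.exp_pos _).le, by rw [Real.exp_le_one_iff]; linarith⟩
      rw [Real.log_exp, neg_neg] at this
      exact this.le
    simpa using norm_integral_le_of_norm_le_const h5
  rw [Metric.tendsto_nhds]
  intro ε hε
  obtain ⟨p, hp⟩ := exists_polynomial_near_of_continuousOn 0 1 _ hF.continuousOn (ε / 4)
    (by positivity)
  have hpT : Tendsto (fun i => ∫ x, p.eval (Real.exp (-x)) ∂(ρ i)) l
      (𝓝 (∫ x, p.eval (Real.exp (-x)) ∂ρ')) := by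
    rw [(key p ρ' inferInstance hρ').2]
    have h6 : Tendsto (fun i => ∑ k ∈ Finset.range (p.natDegree + 1), p.coeff k *
        ∫ x, Real.exp (-((k : ℝ) * x)) ∂(ρ i)) l (𝓝 (∑ k ∈ Finset.range (p.natDegree + 1),
          p.coeff k * ∫ x, Real.exp (-((k : ℝ) * x)) ∂ρ')) := by
      refine tendsto_finsetSum _ fun k _ => Tendsto.const_mul _ ?_
      rcases Nat.eq_zero_or_pos k with rfl | hk
      · refine Tendsto.congr' ?_ tendsto_const_nhds
        filter_upwards [hρ] with i hi
        have := hi.1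
        simp
      · exact hL k (by exact_mod_cast hk)
    refine h6.congr' ?_
    filter_upwards [hρ] with i hi using (key p _ hi.1 hi.2).2.symm
  filter_upwards [hρ, Metric.tendsto_nhds.1 hpT (ε / 4) (by positivity)] with i hi hi2
  have c1 := close p _ hp (ρ i) hi.1 hi.2
  have c2 := close p _ hp ρ' inferInstance hρ'
  rw [Real.dist_eq] at hi2 ⊢
  rw [abs_le] at c1 c2
  rw [abs_lt] at hi2 ⊢
  constructor <;> linarith [c1.1, c1.2, c2.1, c2.2, hi2.1, hi2.2]

/-- The facts about `φ₀` and its derivatives `(-1)^k φ₀^{(k+1)} = U k` that are used. -/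
structure PhiData (φ : ℝ → ℝ) (U : ℕ → ℝ → ℝ) : Prop where
  zero : φ 0 = 0
  nonneg : ∀ y, 0 ≤ y → 0 ≤ φ y
  le : ∀ y, 0 ≤ y → φ y ≤ y
  deriv : ∀ y, 0 < y → HasDerivAt φ (U 0 y) y
  le_one : ∀ y, 0 < y → U 0 y ≤ 1
  seq : DSeq U
  lim_zero : Tendsto (U 0) (𝓝[>] 0) (𝓝 1)
  lim_top : Tendsto (U 0) atTop (𝓝 0)

theorem pow_mul_exp_bound (n : ℕ) {c : ℝ} (hc : 0 < c) {x : ℝ} (hx : 0 ≤ x) :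
    x ^ n * Real.exp (-(c * x)) ≤ n.factorial / c ^ n := by
  have h := Real.pow_div_factorial_le_exp (c * x) (mul_nonneg hc.le hx) n
  rw [div_le_iff₀ (by positivity), mul_pow] at h
  rw [Real.exp_neg, le_div_iff₀ (by positivity), ← div_eq_mul_inv, div_mul_eq_mul_div,
    div_le_iff₀ (Real.exp_pos _)]
  linarith

theorem phiData_of_measure (ν₀ : Measure ℝ) (hν₀supp : ν₀ (Set.Iic 0) = 0)
    (hmass₁ : IntegrableOn (fun x => x) (Set.Ioi 0) ν₀)
    (hmass : ∫ x in Set.Ioi (0:ℝ), x ∂ν₀ = 1)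
    (φ₀ : ℝ → ℝ) (hφ₀ : ∀ s : ℝ, φ₀ s = ∫ x, (1 - Real.exp (-(s * x))) ∂ν₀) :
    PhiData φ₀ (fun k s => ∫ x, x * (x ^ k * Real.exp (-(s * x))) ∂ν₀) := by
  have hpos : ∀ᵐ x ∂ν₀, 0 < x := by
    rw [ae_iff]; simpa [Set.Iic] using! hν₀supp
  have hres : ν₀.restrict (Set.Ioi 0) = ν₀ := Measure.restrict_eq_self_of_ae_mem hpos
  rw [IntegrableOn, hres] at hmass₁
  rw [hres] at hmass
  have hI : ∀ (k : ℕ) (s : ℝ), 0 < s →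
      Integrable (fun x => x * (x ^ k * Real.exp (-(s * x)))) ν₀ := by
    intro k s hs
    refine (hmass₁.mul_const (k.factorial / s ^ k)).mono' (by fun_prop) ?_
    filter_upwards [hpos] with x hx
    rw [Real.norm_of_nonneg (by positivity)]
    exact mul_le_mul_of_nonneg_left (pow_mul_exp_bound k hs hx.le) hx.le
  have hIφ : ∀ s : ℝ, 0 ≤ s → Integrable (fun x => 1 - Real.exp (-(s * x))) ν₀ := by
    intro s hs
    refine (hmass₁.const_mul s).mono' (by fun_prop) ?_
    filter_upwards [hpos] with x hx
    have h1 : Real.exp (-(s * x)) ≤ 1 := by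
      rw [Real.exp_le_one_iff]; have : 0 ≤ s * x := by positivity
      linarith
    rw [Real.norm_of_nonneg (by linarith)]
    have := Real.add_one_le_exp (-(s * x))
    linarith
  refine ⟨by simp [hφ₀], ?_, ?_, ?_, ?_, ⟨?_, ?_⟩, ?_, ?_⟩
  · intro y hy
    rw [hφ₀]
    apply integral_nonneg_of_ae
    filter_upwards [hpos] with x hx
    have h1 : Real.exp (-(y * x)) ≤ 1 := by
      rw [Real.exp_le_one_iff]; have : 0 ≤ y * x := by positivity
      linarith
    simpa using h1
  · intro y hy
    rw [hφ₀]
    have h2 : ∫ x, y * x ∂ν₀ = y := by rw [integral_const_mul, hmass, mul_one]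
    conv_rhs => rw [← h2]
    refine integral_mono (hIφ y hy) (hmass₁.const_mul y) fun x => ?_
    have := Real.add_one_le_exp (-(y * x))
    simp only
    linarith
  · intro y hy
    rw [funext hφ₀]
    refine (hasDerivAt_integral_of_dominated_loc_of_deriv_le (bound := fun x => x)
      (F' := fun s x => x * (x ^ 0 * Real.exp (-(s * x)))) (Ioi_mem_nhds hy)
      (Eventually.of_forall fun s => by fun_prop) (hIφ y hy.le) (by fun_prop) ?_ hmass₁ ?_).2
    · filter_upwards [hpos] with x hx s hs
      have hs : 0 < s := hs
      rw [Real.norm_of_nonneg (by positivity)]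
      have h1 : Real.exp (-(s * x)) ≤ 1 := by
        rw [Real.exp_le_one_iff]; have : 0 ≤ s * x := by positivity
        linarith
      rw [pow_zero, one_mul]
      exact mul_le_of_le_one_right hx.le h1
    · refine Eventually.of_forall fun x s _ => ?_
      have h2 : HasDerivAt (fun s : ℝ => -(s * x)) (-x) s :=
        ((hasDerivAt_id s).mul_const x).neg.congr_deriv (by simp)
      exact (h2.exp.const_sub 1).congr_deriv (by simp; ring)
  · intro y hy
    rw [← hmass]
    refine integral_mono_ae (hI 0 y hy) hmass₁ ?_
    filter_upwards [hpos] with x hx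
    have h1 : Real.exp (-(y * x)) ≤ 1 := by
      rw [Real.exp_le_one_iff]; have : 0 ≤ y * x := by positivity
      linarith
    rw [pow_zero, one_mul]
    exact mul_le_of_le_one_right hx.le h1
  · intro k s hs
    apply integral_nonneg_of_ae
    filter_upwards [hpos] with x hx
    simp only [Pi.zero_apply]
    positivity
  · intro k s hs
    have hs2 : 0 < s / 2 := by positivity
    have := (hasDerivAt_integral_of_dominated_loc_of_deriv_le (μ := ν₀)
      (F := fun s x => x * (x ^ k * Real.exp (-(s * x))))
      (bound := fun x => x * ((k + 1).factorial / (s / 2) ^ (k + 1)))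
      (F' := fun s x => -(x * (x ^ (k + 1) * Real.exp (-(s * x)))))
      (Ioi_mem_nhds (show s / 2 < s by linarith))
      (Eventually.of_forall fun s => by fun_prop) (hI k s hs) (by fun_prop) ?_
      (hmass₁.mul_const _) ?_).2
    · rw [integral_neg] at this
      exact this
    · filter_upwards [hpos] with x hx z hz
      have hz : s / 2 < z := hz
      rw [norm_neg, Real.norm_of_nonneg (by positivity)]
      refine mul_le_mul_of_nonneg_left ?_ hx.le
      refine le_trans ?_ (pow_mul_exp_bound (k + 1) hs2 hx.le)
      gcongr
    · refine Eventually.of_forall fun x s _ => ?_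
      have h2 : HasDerivAt (fun s : ℝ => -(s * x)) (-x) s :=
        ((hasDerivAt_id s).mul_const x).neg.congr_deriv (by simp)
      exact ((h2.exp.const_mul (x ^ k)).const_mul x).congr_deriv (by ring)
  · simp only [pow_zero, one_mul]
    rw [← hmass]
    refine tendsto_integral_filter_of_dominated_convergence (fun x => x) ?_ ?_ hmass₁ ?_
    · exact Eventually.of_forall fun s => by fun_prop
    · filter_upwards [self_mem_nhdsWithin] with s hs
      filter_upwards [hpos] with x hx
      have hs : 0 < s := hs
      rw [Real.norm_of_nonneg (by positivity)]
      have h1 : Real.exp (-(s * x)) ≤ 1 := by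
        rw [Real.exp_le_one_iff]; have : 0 ≤ s * x := by positivity
        linarith
      exact mul_le_of_le_one_right hx.le h1
    · refine Eventually.of_forall fun x => ?_
      have : Continuous (fun s : ℝ => x * Real.exp (-(s * x))) := by fun_prop
      have := this.tendsto 0
      simp only [zero_mul, neg_zero, Real.exp_zero, mul_one] at this
      exact this.mono_left nhdsWithin_le_nhds
  · simp only [pow_zero, one_mul]
    rw [← integral_zero ℝ ℝ (μ := ν₀)]
    refine tendsto_integral_filter_of_dominated_convergence (fun x => x) ?_ ?_ hmass₁ ?_
    · exact Eventually.of_forall fun s => by fun_prop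
    · filter_upwards [eventually_gt_atTop 0] with s hs
      filter_upwards [hpos] with x hx
      rw [Real.norm_of_nonneg (by positivity)]
      have h1 : Real.exp (-(s * x)) ≤ 1 := by
        rw [Real.exp_le_one_iff]; have : 0 ≤ s * x := by positivity
        linarith
      exact mul_le_of_le_one_right hx.le h1
    · filter_upwards [hpos] with x hx
      have := (Real.tendsto_exp_neg_atTop_nhds_zero.comp (tendsto_id.atTop_mul_const hx)).const_mul x
      simpa using! this

theorem DSeq.ncm {D : ℕ → ℝ → ℝ} (hD : DSeq D) (n : ℕ) : ∀ k, NCM n (D k) := by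
  induction n with
  | zero => exact fun k => hD.nonneg k
  | succ n ih => exact fun k => ⟨hD.nonneg k, D (k + 1), hD.deriv k, ih (k + 1)⟩

theorem dseq_of_cm {f : ℝ → ℝ} (hf : CompletelyMonotoneOn f) :
    DSeq (fun k s => (-1 : ℝ) ^ k * iteratedDeriv k f s) := by
  refine ⟨fun k s hs => hf.2 k s hs, fun k s hs => ?_⟩
  have h1 := ((hf.1 k).differentiableAt (Ioi_mem_nhds hs)).hasDerivAt
  rw [← iteratedDeriv_succ] at h1
  exact (h1.const_mul ((-1 : ℝ) ^ k)).congr_deriv (by ring)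

section Sigma

variable {φ : ℝ → ℝ} {U : ℕ → ℝ → ℝ}

theorem PhiData.lip (h : PhiData φ U) {y z : ℝ} (hy : 0 ≤ y) (hyz : y ≤ z) :
    φ z - φ y ≤ z - y := by
  have hm : MonotoneOn (fun x => x - φ x) (Set.Ici 0) := by
    refine monotoneOn_of_deriv_nonneg (convex_Ici 0) ?_ ?_ ?_
    · intro x hx
      rcases (Set.mem_Ici.1 hx).eq_or_lt with rfl | hx
      · have h1 : Tendsto φ (𝓝[≥] 0) (𝓝 0) := by
          refine tendsto_of_tendsto_of_tendsto_of_le_of_le' (h := fun x : ℝ => x)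
            (tendsto_const_nhds (x := (0 : ℝ))) ?_ ?_ ?_
          · exact tendsto_id.mono_left nhdsWithin_le_nhds
          · filter_upwards [self_mem_nhdsWithin] with x hx using h.nonneg x hx
          · filter_upwards [self_mem_nhdsWithin] with x hx using h.le x hx
        have h2 : ContinuousWithinAt φ (Set.Ici 0) 0 := by
          rw [ContinuousWithinAt, h.zero]; exact h1
        exact continuousWithinAt_id.sub h2
      · exact ((hasDerivAt_id x).sub (h.deriv x hx)).continuousAt.continuousWithinAt
    · rw [interior_Ici]
      exact fun x hx => ((hasDerivAt_id x).sub (h.deriv x hx)).differentiableAt.differentiableWithinAt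
    · rw [interior_Ici]
      intro x hx
      have := ((hasDerivAt_id x).sub (h.deriv x hx)).deriv
      have h3 : _root_.deriv (fun x => x - φ x) x = 1 - U 0 x := this
      rw [h3]
      linarith [h.le_one x hx]
  have := hm (Set.mem_Ici.2 hy) (Set.mem_Ici.2 (hy.trans hyz)) hyz
  simp only at this
  linarith

theorem PhiData.mono (h : PhiData φ U) {y z : ℝ} (hy : 0 ≤ y) (hyz : y ≤ z) :
    φ y ≤ φ z := by
  rcases hy.eq_or_lt with rfl | hy
  · rw [h.zero]; exact h.nonneg z hyz
  refine monotoneOn_of_deriv_nonneg (convex_Ioi 0) ?_ ?_ ?_ (Set.mem_Ioi.2 hy)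
    (Set.mem_Ioi.2 (hy.trans_le hyz)) hyz
  · exact fun x hx => (h.deriv x hx).continuousAt.continuousWithinAt
  · rw [interior_Ioi]
    exact fun x hx => (h.deriv x hx).differentiableAt.differentiableWithinAt
  · rw [interior_Ioi]
    intro x hx
    rw [(h.deriv x hx).deriv]
    exact h.seq.nonneg 0 x hx

theorem PhiData.expand (h : PhiData φ U) {a y z : ℝ} (ha : 0 ≤ a) (hy : 0 ≤ y)
    (hz : 0 ≤ z) : (1 - a) * |z - y| ≤ |(z - a * φ z) - (y - a * φ y)| := by
  wlog hyz : y ≤ z generalizing y z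
  · rw [abs_sub_comm z y, abs_sub_comm (z - a * φ z)]
    exact this hz hy (le_of_not_ge hyz)
  have h1 := mul_le_mul_of_nonneg_left (h.lip hy hyz) ha
  rw [abs_of_nonneg (sub_nonneg.2 hyz)]
  refine le_trans ?_ (le_abs_self _)
  linarith

theorem PhiData.exists_sol (h : PhiData φ U) {a s : ℝ} (ha : 0 ≤ a) (ha1 : a < 1) (hs : 0 < s) :
    ∃ y, 0 < y ∧ s = y - a * φ y := by
  have h1a : 0 < 1 - a := by linarith
  have hcont : ContinuousOn (fun y => y - a * φ y) (Set.Icc s (s / (1 - a))) := by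
    intro y hy
    have hy0 : 0 < y := hs.trans_le hy.1
    exact ((hasDerivAt_id y).sub ((h.deriv y hy0).const_mul a)).continuousAt.continuousWithinAt
  have hle : s ≤ s / (1 - a) := by
    rw [le_div_iff₀ h1a]; nlinarith
  obtain ⟨y, hy, hys⟩ := intermediate_value_Icc hle hcont (show s ∈ _ by
    refine ⟨?_, ?_⟩
    · have := mul_nonneg ha (h.nonneg s hs.le)
      linarith
    · have h2 := mul_le_mul_of_nonneg_left (h.le (s / (1 - a)) (by positivity)) ha
      have h3 : s = s / (1 - a) - a * (s / (1 - a)) := by field_simp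
      linarith)
  exact ⟨y, hs.trans_le hy.1, hys.symm⟩

theorem PhiData.sol_unique (h : PhiData φ U) {a y z : ℝ} (ha : 0 ≤ a) (ha1 : a < 1)
    (hy : 0 ≤ y) (hz : 0 ≤ z) (he : y - a * φ y = z - a * φ z) : z = y := by
  have := h.expand ha hy hz
  rw [he, sub_self, abs_zero] at this
  have h1a : 0 < 1 - a := by linarith
  have h2 : |z - y| ≤ 0 := by
    by_contra hc
    push Not at hc
    nlinarith
  have := abs_nonpos_iff.1 h2
  linarith

/-- The properties of the solution map at a fixed time. -/
structure IsSol (φ : ℝ → ℝ) (a : ℝ) (S : ℝ → ℝ) : Prop where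
  pos : ∀ s, 0 < s → 0 < S s
  eq : ∀ s, 0 < s → s = S s - a * φ (S s)

theorem IsSol.hasDerivAt {a : ℝ} {S : ℝ → ℝ} (hS : IsSol φ a S) (h : PhiData φ U) (ha : 0 ≤ a)
    (ha1 : a < 1) {s : ℝ} (hs : 0 < s) : HasDerivAt S (1 - a * U 0 (S s))⁻¹ s := by
  have h1a : 0 < 1 - a := by linarith
  have hc : ContinuousAt S s := by
    rw [ContinuousAt, tendsto_iff_dist_tendsto_zero]
    have hlim : Tendsto (fun x => |x - s| / (1 - a)) (𝓝 s) (𝓝 0) := by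
      have : Continuous (fun x => |x - s| / (1 - a)) := by fun_prop
      simpa using this.tendsto s
    refine squeeze_zero' (Eventually.of_forall fun _ => dist_nonneg) ?_ hlim
    filter_upwards [Ioi_mem_nhds hs] with x hx
    rw [Real.dist_eq, le_div_iff₀ h1a, mul_comm]
    refine (h.expand ha (hS.pos s hs).le (hS.pos x hx).le).trans ?_
    rw [← hS.eq s hs, ← hS.eq x hx]
  have hd : HasDerivAt (fun y => y - a * φ y) (1 - a * U 0 (S s)) (S s) :=
    (hasDerivAt_id _).sub ((h.deriv _ (hS.pos s hs)).const_mul a)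
  refine HasDerivAt.of_local_left_inverse hc hd ?_ ?_
  · have := mul_le_mul_of_nonneg_left (h.le_one _ (hS.pos s hs)) ha
    linarith
  · filter_upwards [Ioi_mem_nhds hs] with x hx using (hS.eq x hx).symm

theorem PhiData.denom_pos (h : PhiData φ U) {a y : ℝ} (ha : 0 ≤ a) (hy : 0 < y) :
    1 - a ≤ 1 - a * U 0 y := by
  have := mul_le_mul_of_nonneg_left (h.le_one _ hy) ha
  linarith

theorem PhiData.ncm_inv (h : PhiData φ U) {a : ℝ} (ha : 0 ≤ a) (ha1 : a < 1) (n : ℕ) :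
    NCM n (fun y => (1 - a * U 0 y)⁻¹) := by
  have hpos : ∀ y : ℝ, 0 < y → 0 < 1 - a * U 0 y := fun y hy => by
    linarith [h.denom_pos ha hy]
  induction n with
  | zero => exact fun y hy => (inv_pos.2 (hpos y hy)).le
  | succ n ih =>
    refine ⟨fun y hy => (inv_pos.2 (hpos y hy)).le,
      fun y => a * (U 1 y * ((1 - a * U 0 y)⁻¹ * (1 - a * U 0 y)⁻¹)), fun y hy => ?_,
      (NCM.const ha).mul ((h.seq.ncm n 1).mul (ih.mul ih))⟩
    have h1 : HasDerivAt (fun y => 1 - a * U 0 y) (-(a * -(U 1 y))) y :=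
      ((h.seq.deriv 0 y hy).const_mul a).const_sub 1
    refine (h1.inv (hpos y hy).ne').congr_deriv ?_
    have := (hpos y hy).ne'
    field_simp

theorem IsSol.ncm {a : ℝ} {S : ℝ → ℝ} (hS : IsSol φ a S) (h : PhiData φ U) (ha : 0 ≤ a)
    (ha1 : a < 1) (n : ℕ) : NCM n (fun s => (1 - a * U 0 (S s))⁻¹) := by
  induction n with
  | zero => exact fun s hs => h.ncm_inv ha ha1 0 _ (hS.pos s hs)
  | succ n ih =>
    exact NCM.comp hS.pos (fun s hs => hS.hasDerivAt h ha ha1 hs) ih (h.ncm_inv ha ha1 (n + 1))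

theorem IsSol.ncm_u {a : ℝ} {S : ℝ → ℝ} (hS : IsSol φ a S) (h : PhiData φ U) (ha : 0 ≤ a)
    (ha1 : a < 1) (n : ℕ) : NCM n (fun s => U 0 (S s)) :=
  NCM.pred (NCM.comp hS.pos (fun s hs => hS.hasDerivAt h ha ha1 hs) (hS.ncm h ha ha1 n)
    (h.seq.ncm (n + 1) 0))

theorem IsSol.le {a : ℝ} {S : ℝ → ℝ} (hS : IsSol φ a S) (h : PhiData φ U) (ha : 0 ≤ a)
    (ha1 : a < 1) {s : ℝ} (hs : 0 < s) : s ≤ S s ∧ S s ≤ s / (1 - a) := by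
  have h1 := hS.eq s hs
  have hp := (hS.pos s hs).le
  have h2 := mul_nonneg ha (h.nonneg _ hp)
  have h3 := mul_le_mul_of_nonneg_left (h.le _ hp) ha
  refine ⟨by linarith, ?_⟩
  rw [le_div_iff₀ (by linarith)]
  linarith

theorem IsSol.lim_zero {a : ℝ} {S : ℝ → ℝ} (hS : IsSol φ a S) (h : PhiData φ U) (ha : 0 ≤ a)
    (ha1 : a < 1) :
    Tendsto (fun s => (1 - a) * U 0 (S s) * (1 - a * U 0 (S s))⁻¹) (𝓝[>] 0) (𝓝 1) := by
  have hS0 : Tendsto S (𝓝[>] 0) (𝓝[>] 0) := by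
    refine tendsto_nhdsWithin_iff.2 ⟨?_, ?_⟩
    · have hlim : Tendsto (fun s => s / (1 - a)) (𝓝[>] 0) (𝓝 0) := by
        have : Continuous (fun s => s / (1 - a)) := by fun_prop
        have := this.tendsto 0
        rw [zero_div] at this
        exact this.mono_left nhdsWithin_le_nhds
      refine squeeze_zero' ?_ ?_ hlim
      · filter_upwards [self_mem_nhdsWithin] with s hs using (hS.pos s hs).le
      · filter_upwards [self_mem_nhdsWithin] with s hs using (hS.le h ha ha1 hs).2
    · filter_upwards [self_mem_nhdsWithin] with s hs using hS.pos s hs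
  have hU := h.lim_zero.comp hS0
  have h1a : (1 : ℝ) - a * 1 ≠ 0 := by
    have : 0 < 1 - a * 1 := by linarith
    exact this.ne'
  have := (hU.const_mul (1 - a)).mul (((hU.const_mul a).const_sub 1).inv₀ h1a)
  convert! this using 2
  rw [mul_one] at h1a
  field_simp

theorem IsSol.lim_top {a : ℝ} {S : ℝ → ℝ} (hS : IsSol φ a S) (h : PhiData φ U) (ha : 0 ≤ a)
    (ha1 : a < 1) :
    Tendsto (fun s => (1 - a) * U 0 (S s) * (1 - a * U 0 (S s))⁻¹) atTop (𝓝 0) := by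
  have hS0 : Tendsto S atTop atTop := by
    refine tendsto_atTop_mono' _ ?_ tendsto_id
    filter_upwards [eventually_gt_atTop 0] with s hs using (hS.le h ha ha1 hs).1
  have hU := h.lim_top.comp hS0
  have h1a : (1 : ℝ) - a * 0 ≠ 0 := by simp
  have := (hU.const_mul (1 - a)).mul (((hU.const_mul a).const_sub 1).inv₀ h1a)
  convert! this using 2
  simp

end Sigma

theorem sol_tendsto {φ : ℝ → ℝ} {U : ℕ → ℝ → ℝ} (h : PhiData φ U) {σ : ℝ → ℝ → ℝ}
    (hσ : ∀ t : ℝ, 0 ≤ t → IsSol φ (1 - Real.exp (-t)) (σ t)) {s t : ℝ} (hs : 0 < s)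
    (ht : 0 ≤ t) : Tendsto (fun τ => σ τ s) (𝓝[Set.Ici 0] t) (𝓝 (σ t s)) := by
  rw [tendsto_iff_dist_tendsto_zero]
  have hlim : Tendsto (fun τ => |Real.exp (-t) - Real.exp (-τ)| * φ (σ t s) / Real.exp (-τ))
      (𝓝[Set.Ici 0] t) (𝓝 0) := by
    have hc : Continuous
        (fun τ => |Real.exp (-t) - Real.exp (-τ)| * φ (σ t s) / Real.exp (-τ)) :=
      Continuous.div (by fun_prop) (by fun_prop) fun τ => (Real.exp_pos _).ne'
    have := hc.tendsto t
    simp only [sub_self, abs_zero, zero_mul, zero_div] at this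
    exact this.mono_left nhdsWithin_le_nhds
  refine squeeze_zero' (Eventually.of_forall fun _ => dist_nonneg) ?_ hlim
  filter_upwards [self_mem_nhdsWithin] with τ hτ
  have hτ : 0 ≤ τ := hτ
  have h0 : 0 ≤ 1 - Real.exp (-τ) := by
    have : Real.exp (-τ) ≤ 1 := by rw [Real.exp_le_one_iff]; linarith
    linarith
  rw [Real.dist_eq, le_div_iff₀ (Real.exp_pos _)]
  have h1 := h.expand h0 ((hσ t ht).pos s hs).le ((hσ τ hτ).pos s hs).le
  rw [← (hσ τ hτ).eq s hs] at h1
  have h2 : s - (σ t s - (1 - Real.exp (-τ)) * φ (σ t s)) =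
      (Real.exp (-t) - Real.exp (-τ)) * φ (σ t s) := by
    have := (hσ t ht).eq s hs
    linarith
  rw [h2, abs_mul, abs_of_nonneg (h.nonneg _ ((hσ t ht).pos s hs).le)] at h1
  linarith

theorem density_facts (ρ : Measure ℝ) [IsProbabilityMeasure ρ] (hρ : ρ (Set.Iic 0) = 0) :
    (ρ.withDensity fun x => ENNReal.ofReal x⁻¹) (Set.Iic 0) = 0 ∧
    IntegrableOn (fun x => x) (Set.Ioi 0) (ρ.withDensity fun x => ENNReal.ofReal x⁻¹) ∧
    ∀ f : ℝ → ℝ, ∫ x in Set.Ioi (0 : ℝ), f x * x ∂(ρ.withDensity fun x => ENNReal.ofReal x⁻¹) =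
      ∫ x, f x ∂ρ := by
  have hpos : ∀ᵐ x ∂ρ, 0 < x := by
    rw [ae_iff]; simpa [Set.Iic] using! hρ
  have hm : Measurable fun x : ℝ => ENNReal.ofReal x⁻¹ := by fun_prop
  have hac := withDensity_absolutelyContinuous ρ (fun x : ℝ => ENNReal.ofReal x⁻¹)
  have hres : (ρ.withDensity fun x => ENNReal.ofReal x⁻¹).restrict (Set.Ioi 0) =
      ρ.withDensity fun x => ENNReal.ofReal x⁻¹ :=
    Measure.restrict_eq_self_of_ae_mem (hac.ae_le hpos)
  refine ⟨hac hρ, ?_, fun f => ?_⟩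
  · rw [IntegrableOn, hres, integrable_withDensity_iff_integrable_smul' hm (by simp)]
    refine (integrable_const (1 : ℝ)).congr ?_
    filter_upwards [hpos] with x hx
    rw [ENNReal.toReal_ofReal (by positivity), smul_eq_mul, inv_mul_cancel₀ hx.ne']
  · rw [hres, integral_withDensity_eq_integral_toReal_smul hm (by simp)]
    refine integral_congr_ae ?_
    filter_upwards [hpos] with x hx
    rw [ENNReal.toReal_ofReal (by positivity), smul_eq_mul]
    field_simp

theorem additive_kernel_characteristics
    (ν₀ : Measure ℝ) (hν₀supp : ν₀ (Set.Iic 0) = 0)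
    (hmass₁ : IntegrableOn (fun x => x) (Set.Ioi 0) ν₀)
    (hmass : ∫ x in Set.Ioi (0:ℝ), x ∂ν₀ = 1)
    (φ₀ : ℝ → ℝ) (hφ₀ : ∀ s : ℝ, φ₀ s = ∫ x, (1 - Real.exp (-(s * x))) ∂ν₀) :
    ∃ σ : ℝ → ℝ → ℝ,
      -- (i) σ(t,s) > 0 is the unique solution of s = σ − (1 − e^{−t}) φ₀(σ),
      (∀ t : ℝ, 0 ≤ t → ∀ s : ℝ, 0 < s →
        0 < σ t s ∧ s = σ t s - (1 - Real.exp (-t)) * φ₀ (σ t s) ∧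
        ∀ σ' : ℝ, 0 < σ' → s = σ' - (1 - Real.exp (-t)) * φ₀ σ' → σ' = σ t s) ∧
      -- and s ↦ dσ/ds is completely monotone
      (∀ t : ℝ, 0 ≤ t → CompletelyMonotoneOn (deriv (σ t))) ∧
      -- (ii) u(t,s) = e^{−t} u₀(σ(t,s)) dσ/ds is completely monotone in s
      -- with u(t,0⁺) = 1, where u₀ = φ₀′
      (∀ t : ℝ, 0 ≤ t →
        CompletelyMonotoneOn (fun s => Real.exp (-t) * deriv φ₀ (σ t s) * deriv (σ t) s) ∧
        Tendsto (fun s => Real.exp (-t) * deriv φ₀ (σ t s) * deriv (σ t) s)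
          (𝓝[>] (0:ℝ)) (𝓝 1)) ∧
      -- hence there is a family of positive measures ν_t realizing u(t,·) as the
      -- Laplace transform of the mass measure x ν_t(dx),
      ∃ ν : ℝ → Measure ℝ,
        (∀ t : ℝ, 0 ≤ t → (ν t) (Set.Iic 0) = 0 ∧
          ∀ s : ℝ, 0 < s →
            ∫ x in Set.Ioi (0:ℝ), Real.exp (-(s * x)) * x ∂(ν t) =
              Real.exp (-t) * deriv φ₀ (σ t s) * deriv (σ t) s) ∧
        -- with unit mass for all times,
        (∀ t : ℝ, 0 ≤ t → IntegrableOn (fun x => x) (Set.Ioi 0) (ν t) ∧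
          ∫ x in Set.Ioi (0:ℝ), x ∂(ν t) = 1) ∧
        -- and t ↦ x ν_t(dx) weakly continuous
        (∀ f : ℝ → ℝ, Continuous f → HasCompactSupport f → tsupport f ⊆ Set.Ioi 0 →
          ∀ t : ℝ, 0 ≤ t →
            Tendsto (fun τ => ∫ x in Set.Ioi (0:ℝ), f x * x ∂(ν τ)) (𝓝[Set.Ici 0] t)
              (𝓝 (∫ x in Set.Ioi (0:ℝ), f x * x ∂(ν t)))) := by
  obtain ⟨U, h⟩ : ∃ U, PhiData φ₀ U := ⟨_, phiData_of_measure ν₀ hν₀supp hmass₁ hmass φ₀ hφ₀⟩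
  have ha : ∀ t : ℝ, 0 ≤ t → 0 ≤ 1 - Real.exp (-t) := fun t ht => by
    have : Real.exp (-t) ≤ 1 := by rw [Real.exp_le_one_iff]; linarith
    linarith
  have ha1 : ∀ t : ℝ, 1 - Real.exp (-t) < 1 := fun t => by linarith [Real.exp_pos (-t)]
  have hex : ∀ t s : ℝ, ∃ y : ℝ, 0 ≤ t → 0 < s → 0 < y ∧ s = y - (1 - Real.exp (-t)) * φ₀ y := by
    intro t s
    by_cases hts : 0 ≤ t ∧ 0 < s
    · obtain ⟨y, hy⟩ := h.exists_sol (ha t hts.1) (ha1 t) hts.2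
      exact ⟨y, fun _ _ => hy⟩
    · exact ⟨0, fun h1 h2 => absurd ⟨h1, h2⟩ hts⟩
  choose σ hσ using hex
  have hS : ∀ t : ℝ, 0 ≤ t → IsSol φ₀ (1 - Real.exp (-t)) (σ t) := fun t ht =>
    ⟨fun s hs => (hσ t s ht hs).1, fun s hs => (hσ t s ht hs).2⟩
  have hdσ : ∀ t : ℝ, 0 ≤ t → ∀ s : ℝ, 0 < s →
      deriv (σ t) s = (1 - (1 - Real.exp (-t)) * U 0 (σ t s))⁻¹ := fun t ht s hs =>
    ((hS t ht).hasDerivAt h (ha t ht) (ha1 t) hs).deriv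
  have hdφ : ∀ t : ℝ, 0 ≤ t → ∀ s : ℝ, 0 < s → deriv φ₀ (σ t s) = U 0 (σ t s) :=
    fun t ht s hs => (h.deriv _ ((hS t ht).pos s hs)).deriv
  have hu : ∀ t : ℝ, 0 ≤ t → ∀ s : ℝ, 0 < s →
      Real.exp (-t) * deriv φ₀ (σ t s) * deriv (σ t) s =
      (1 - (1 - Real.exp (-t))) * U 0 (σ t s) * (1 - (1 - Real.exp (-t)) * U 0 (σ t s))⁻¹ := by
    intro t ht s hs
    rw [hdσ t ht s hs, hdφ t ht s hs, sub_sub_cancel]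
  have hcm : ∀ t : ℝ, 0 ≤ t →
      CompletelyMonotoneOn (fun s => Real.exp (-t) * deriv φ₀ (σ t s) * deriv (σ t) s) := by
    intro t ht
    refine NCM.cm fun n => NCM.congr
      (((NCM.const (Real.exp_pos (-t)).le).mul ((hS t ht).ncm_u h (ha t ht) (ha1 t) n)).mul
      ((hS t ht).ncm h (ha t ht) (ha1 t) n)) fun s hs => ?_
    rw [hdσ t ht s hs, hdφ t ht s hs]
  have hlim0 : ∀ t : ℝ, 0 ≤ t →
      Tendsto (fun s => Real.exp (-t) * deriv φ₀ (σ t s) * deriv (σ t) s)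
          (𝓝[>] (0:ℝ)) (𝓝 1) := by
    intro t ht
    refine ((hS t ht).lim_zero h (ha t ht) (ha1 t)).congr' ?_
    filter_upwards [self_mem_nhdsWithin] with s hs using (hu t ht s hs).symm
  have hlimtop : ∀ t : ℝ, 0 ≤ t →
      Tendsto (fun s => Real.exp (-t) * deriv φ₀ (σ t s) * deriv (σ t) s) atTop (𝓝 0) := by
    intro t ht
    refine ((hS t ht).lim_top h (ha t ht) (ha1 t)).congr' ?_
    filter_upwards [eventually_gt_atTop 0] with s hs using (hu t ht s hs).symm
  have hbern : ∀ t : ℝ, ∃ ρ : Measure ℝ, 0 ≤ t → IsProbabilityMeasure ρ ∧ ρ (Set.Iic 0) = 0 ∧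
      ∀ s : ℝ, 0 < s → ∫ x, Real.exp (-(s * x)) ∂ρ =
        Real.exp (-t) * deriv φ₀ (σ t s) * deriv (σ t) s := by
    intro t
    by_cases ht : 0 ≤ t
    · obtain ⟨ρ, h1, h2, h3⟩ := bernstein_thm (dseq_of_cm (hcm t ht)) (by simpa using hlim0 t ht)
        (by simpa using hlimtop t ht)
      exact ⟨ρ, fun _ => ⟨h1, h2, fun s hs => by simpa using h3 s hs⟩⟩
    · exact ⟨0, fun h' => absurd h' ht⟩
  choose ρ hρ using hbern
  refine ⟨σ, ?_, ?_, fun t ht => ⟨hcm t ht, hlim0 t ht⟩,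
    fun t => (ρ t).withDensity fun x => ENNReal.ofReal x⁻¹, ?_, ?_, ?_⟩
  · intro t ht s hs
    refine ⟨(hS t ht).pos s hs, (hS t ht).eq s hs, fun y hy hys => ?_⟩
    exact h.sol_unique (ha t ht) (ha1 t) ((hS t ht).pos s hs).le hy.le
      ((hS t ht).eq s hs ▸ hys)
  · intro t ht
    exact NCM.cm fun n => NCM.congr ((hS t ht).ncm h (ha t ht) (ha1 t) n) (hdσ t ht)
  · intro t ht
    obtain ⟨h1, h2, h3⟩ := hρ t ht
    obtain ⟨d1, d2, d3⟩ := density_facts (ρ t) h2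
    exact ⟨d1, fun s hs => by rw [d3 fun x => Real.exp (-(s * x)), h3 s hs]⟩
  · intro t ht
    obtain ⟨h1, h2, h3⟩ := hρ t ht
    obtain ⟨d1, d2, d3⟩ := density_facts (ρ t) h2
    exact ⟨d2, by simpa using d3 fun _ => 1⟩
  · intro f hf hfc hfs t ht
    obtain ⟨h1, h2, h3⟩ := hρ t ht
    rw [(density_facts (ρ t) h2).2.2 f]
    have hw : Tendsto (fun τ => ∫ x, f x ∂(ρ τ)) (𝓝[Set.Ici 0] t) (𝓝 (∫ x, f x ∂(ρ t))) := by
      refine weak_of_laplace ?_ h2 (fun s hs => ?_) hf hfc hfs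
      · filter_upwards [self_mem_nhdsWithin] with τ hτ using ⟨(hρ τ hτ).1, (hρ τ hτ).2.1⟩
      · have hσt := sol_tendsto h hS hs ht
        have hU := ((h.seq.deriv 0 _ ((hS t ht).pos s hs)).continuousAt.tendsto).comp hσt
        have hE : Tendsto (fun τ : ℝ => 1 - Real.exp (-τ)) (𝓝[Set.Ici 0] t)
            (𝓝 (1 - Real.exp (-t))) :=
          ((by fun_prop : Continuous fun τ : ℝ => 1 - Real.exp (-τ)).tendsto t).mono_left
            nhdsWithin_le_nhds
        have hne : 1 - (1 - Real.exp (-t)) * U 0 (σ t s) ≠ 0 := by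
          have := h.denom_pos (ha t ht) ((hS t ht).pos s hs)
          linarith [Real.exp_pos (-t)]
        have hT := ((hE.const_sub 1).mul hU).mul (((hE.mul hU).const_sub 1).inv₀ hne)
        rw [h3 s hs, hu t ht s hs]
        refine hT.congr' ?_
        filter_upwards [self_mem_nhdsWithin] with τ hτ
        rw [(hρ τ hτ).2.2 s hs, hu τ hτ s hs]
        rfl
    refine hw.congr' ?_
    filter_upwards [self_mem_nhdsWithin] with τ hτ
    have := (hρ τ hτ).1
    rw [(density_facts (ρ τ) (hρ τ hτ).2.1).2.2 f]
end
end

section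
/- Integral representation and complete monotonicity of the Mittag-Leffler function along a power: For 0 < ρ < 1 and x > 0, E_ρ(−x^ρ) = (1/π) ∫₀^∞ e^{−rx} r^{ρ−1} sin(πρ) / ((r^ρ + cos πρ)² + (sin πρ)²) dr, where E_ρ(z) = Σ_{k=0}^∞ z^k / Γ(1+ρk) is the Mittag-Leffler function. Consequently both x ↦ E_ρ(−x^ρ) and the Mittag-Leffler density n_ρ(x) = −∂_x E_ρ(−x^ρ) are completely monotone on (0,∞). -/
/-!
Integral representation and complete monotonicity of the Mittag-Leffler
function along a power (Menon–Pego, Lemma 4.1, after Tsoukatos).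
-/

open MeasureTheory Filter Topology Set Real

noncomputable section

/-- The Mittag-Leffler function E_ρ(z) = Σ_{k=0}^∞ z^k / Γ(1+ρk). -/
def mittagLeffler (ρ z : ℝ) : ℝ :=
  ∑' k : ℕ, z ^ k / Real.Gamma (1 + ρ * (k : ℝ))

def GG (ρ : ℝ) (w : ℂ) : ℂ := Complex.exp (ρ * w) / (1 + Complex.exp (ρ * w))

lemma one_add_exp_ne {w : ℂ} (h : |w.im| < π) : 1 + Complex.exp w ≠ 0 := by
  intro h0
  have h1 : Complex.exp w = Complex.exp (π * Complex.I) := by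
    rw [Complex.exp_pi_mul_I]; linear_combination h0
  rw [Complex.exp_eq_exp_iff_exists_int] at h1
  obtain ⟨n, hn⟩ := h1
  have h2 := congrArg Complex.im hn
  simp at h2
  rw [abs_lt] at h
  have hp := Real.pi_pos
  rw [h2] at h
  have h3 : (n:ℝ) < 0 := by nlinarith
  have h4 : (-1:ℝ) < n := by nlinarith
  have h5 : n < 0 := by exact_mod_cast h3
  have h6 : -1 < n := by exact_mod_cast h4
  omega

lemma exp_inj_strip {w a : ℂ} (h : |(w - a).im| < 2 * π) (he : Complex.exp w = Complex.exp a) :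
    w = a := by
  rw [Complex.exp_eq_exp_iff_exists_int] at he
  obtain ⟨n, hn⟩ := he
  have h2 : (w - a).im = n * (2 * π) := by
    rw [hn]; simp
  rw [h2, abs_lt] at h
  have hp := Real.pi_pos
  have h3 : (n:ℝ) < 1 := by nlinarith
  have h4 : (-1:ℝ) < n := by nlinarith
  have h5 : n < 1 := by exact_mod_cast h3
  have h6 : -1 < n := by exact_mod_cast h4
  have : n = 0 := by omega
  simpa [this] using hn

lemma tendsto_vert {f : ℂ → ℂ} (hf : Measurable f) {L : ℂ} {l : Filter ℝ} [l.IsCountablyGenerated]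
    (h : Tendsto f (comap Complex.re l) (𝓝 L)) :
    Tendsto (fun R : ℝ => ∫ y : ℝ in (-π)..π, f (R + y * Complex.I)) l (𝓝 (2 * π * L)) := by
  have h1 : ∀ᶠ w in comap Complex.re l, ‖f w‖ < ‖L‖ + 1 :=
    h.norm.eventually_lt_const (by linarith)
  rw [eventually_comap] at h1
  have key := intervalIntegral.tendsto_integral_filter_of_dominated_convergence
    (μ := volume) (a := -π) (b := π) (l := l) (F := fun (R : ℝ) (y : ℝ) => f (R + y * Complex.I))
    (f := fun _ => L) (fun _ => ‖L‖ + 1) ?_ ?_ ?_ ?_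
  · have e : (∫ _ in (-π)..π, L) = 2 * π * L := by
      rw [intervalIntegral.integral_const, Complex.real_smul]
      push_cast; ring
    rwa [e] at key
  · filter_upwards with R
    exact (hf.comp (by fun_prop)).aestronglyMeasurable
  · filter_upwards [h1] with R hR
    filter_upwards with y _
    exact (hR _ (by simp)).le
  · simp
  · filter_upwards with y _
    apply h.comp
    rw [tendsto_comap_iff]
    have e : (Complex.re ∘ fun R : ℝ => (R : ℂ) + y * Complex.I) = id := by ext R; simp
    rw [e]
    exact tendsto_id

lemma GG_diff (ρ : ℝ) :
    DifferentiableOn ℂ (GG ρ) {w | |ρ * w.im| < π} := by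
  intro w hw
  apply DifferentiableAt.differentiableWithinAt
  unfold GG
  refine DifferentiableAt.div (by fun_prop) (by fun_prop) ?_
  apply one_add_exp_ne
  simpa using hw

def ff (ρ s : ℝ) (w : ℂ) : ℂ := (GG ρ w - GG ρ (Real.log s)) / (Complex.exp w - s)

lemma ff_meas (ρ s : ℝ) : Measurable (ff ρ s) := by
  unfold ff GG; fun_prop

lemma ff_rect {ρ : ℝ} (hρ : ρ ∈ Set.Ioo (0:ℝ) 1) {s : ℝ} (hs : 0 < s) {R : ℝ}
    (hR : |Real.log s| < R) :
    (∫ x : ℝ in (-R)..R, ff ρ s (x + (-π : ℝ) * Complex.I))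
      - (∫ x : ℝ in (-R)..R, ff ρ s (x + (π:ℝ) * Complex.I)) +
      Complex.I • (∫ y : ℝ in (-π)..π, ff ρ s (R + y * Complex.I)) -
      Complex.I • (∫ y : ℝ in (-π)..π, ff ρ s ((-R : ℝ) + y * Complex.I)) = 0 := by
  have hp := Real.pi_pos
  have hR0 : 0 < R := lt_of_le_of_lt (abs_nonneg _) hR
  set a : ℂ := (Real.log s : ℂ) with ha
  have hsa : Complex.exp a = s := by
    rw [ha, ← Complex.ofReal_exp, Real.exp_log hs]
  set q : ℂ → ℂ := fun w => dslope (GG ρ) a w / dslope Complex.exp a w with hq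
  have hU : IsOpen {w : ℂ | |ρ * w.im| < π} := by
    apply isOpen_lt <;> fun_prop
  have haU : {w : ℂ | |ρ * w.im| < π} ∈ 𝓝 a := hU.mem_nhds (by simp [ha, hp])
  have hqf : ∀ w, w ≠ a → q w = ff ρ s w := by
    intro w hw
    have : w - a ≠ 0 := sub_ne_zero.2 hw
    simp only [hq, dslope_of_ne _ hw, slope_def_field, ff, hsa, ← ha]
    field_simp
  have hd : DifferentiableOn ℂ q (uIcc (-R) R ×ℂ uIcc (-π) π) := by
    intro w hw
    rw [uIcc_of_le (by linarith), uIcc_of_le (by linarith)] at hw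
    obtain ⟨hw1, hw2⟩ := hw
    simp only [mem_preimage, mem_Icc] at hw1 hw2
    have hwU : w ∈ {w : ℂ | |ρ * w.im| < π} := by
      simp only [mem_ofPred_eq, abs_lt]
      have := hρ.1; have := hρ.2
      constructor <;> nlinarith
    refine DifferentiableWithinAt.div ?_ ?_ ?_
    · exact ((((Complex.differentiableOn_dslope haU).2 (GG_diff ρ)) w hwU).differentiableAt
        (hU.mem_nhds hwU)).differentiableWithinAt
    · exact ((((Complex.differentiableOn_dslope (s := univ) univ_mem).2
        Complex.differentiable_exp.differentiableOn) w (mem_univ _)).differentiableAt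
        univ_mem).differentiableWithinAt
    · by_cases hwa : w = a
      · rw [hwa, dslope_same]; simp
      · rw [dslope_of_ne _ hwa, slope_def_field]
        refine div_ne_zero ?_ (sub_ne_zero.2 hwa)
        intro h
        apply hwa
        apply exp_inj_strip _ (sub_eq_zero.1 h)
        simp only [ha, Complex.sub_im, Complex.ofReal_im, abs_lt]
        constructor <;> linarith
  have := Complex.integral_boundary_rect_eq_zero_of_differentiableOn q
    ⟨-R, -π⟩ ⟨R, π⟩ hd
  simp only at this
  have e1 : ∀ x : ℝ, q (x + (-π:ℝ) * Complex.I) = ff ρ s (x + (-π : ℝ) * Complex.I) := by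
    intro x; apply hqf
    intro h
    have := congrArg Complex.im h
    simp [ha] at this
  have e2 : ∀ x : ℝ, q (x + (π:ℝ) * Complex.I) = ff ρ s (x + (π : ℝ) * Complex.I) := by
    intro x; apply hqf
    intro h
    have := congrArg Complex.im h
    simp [ha] at this
  have e3 : ∀ y : ℝ, q (R + y * Complex.I) = ff ρ s (R + y * Complex.I) := by
    intro x; apply hqf
    intro h
    have := congrArg Complex.re h
    simp [ha] at this
    have := (abs_lt.1 hR).2
    linarith
  have e4 : ∀ y : ℝ, q ((-R : ℝ) + y * Complex.I) = ff ρ s ((-R : ℝ) + y * Complex.I) := by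
    intro x; apply hqf
    intro h
    have := congrArg Complex.re h
    simp [ha] at this
    have := (abs_lt.1 hR).1
    linarith
  simp only [e1, e2, e3, e4] at this
  exact this

def kk (ρ : ℝ) (x : ℝ) : ℝ :=
  rexp (ρ * x) * sin (π * ρ) / ((rexp (ρ * x) + cos (π * ρ)) ^ 2 + sin (π * ρ) ^ 2)

lemma sin_pos' {ρ : ℝ} (hρ : ρ ∈ Set.Ioo (0:ℝ) 1) : 0 < sin (π * ρ) := by
  have := hρ.1; have := hρ.2; have := Real.pi_pos
  apply sin_pos_of_pos_of_lt_pi <;> nlinarith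

lemma den_pos {ρ : ℝ} (hρ : ρ ∈ Set.Ioo (0:ℝ) 1) (t : ℝ) :
    0 < (t + cos (π * ρ)) ^ 2 + sin (π * ρ) ^ 2 := by
  have := sin_pos' hρ
  positivity

lemma ff_diff {ρ : ℝ} (hρ : ρ ∈ Set.Ioo (0:ℝ) 1) {s : ℝ} (hs : 0 < s) (x : ℝ) :
    ff ρ s (x + (-π : ℝ) * Complex.I) - ff ρ s (x + (π:ℝ) * Complex.I) =
      2 * Complex.I * ((kk ρ x / (rexp x + s) : ℝ) : ℂ) := by
  have hp := den_pos hρ (rexp (ρ * x))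
  have e1 : Complex.exp (x + (-π : ℝ) * Complex.I) = - rexp x := by
    rw [Complex.exp_add]; simp [Complex.exp_neg]
  have e2 : Complex.exp (x + (π : ℝ) * Complex.I) = - rexp x := by
    rw [Complex.exp_add]; simp
  have e3 : Complex.exp (ρ * (x + (π : ℝ) * Complex.I)) =
      rexp (ρ * x) * (cos (π * ρ) + sin (π * ρ) * Complex.I) := by
    rw [mul_add, Complex.exp_add, ← mul_assoc, mul_comm (ρ:ℂ) (π:ℝ), Complex.exp_mul_I]
    push_cast; rfl
  have e4 : Complex.exp (ρ * (x + (-π : ℝ) * Complex.I)) =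
      rexp (ρ * x) * (cos (π * ρ) - sin (π * ρ) * Complex.I) := by
    rw [mul_add, Complex.exp_add, ← mul_assoc, mul_comm (ρ:ℂ) (-π:ℝ), Complex.exp_mul_I]
    push_cast
    rw [neg_mul, Complex.cos_neg, Complex.sin_neg]; ring
  have hes : rexp x + s ≠ 0 := by positivity
  unfold ff GG kk
  rw [e1, e2, e3, e4]
  set t := rexp (ρ * x)
  have hcs := Real.sin_sq_add_cos_sq (π * ρ)
  set c := cos (π * ρ)
  set d := sin (π * ρ)
  have hprod : (1 + (t:ℂ) * (c + d * Complex.I)) * (1 + (t:ℂ) * (c - d * Complex.I)) =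
      (((t + c)^2 + d^2 : ℝ) : ℂ) := by
    have : (1 + t * c)^2 + (t*d)^2 = (t + c)^2 + d^2 := by
      linear_combination (t ^ 2 - 1) * hcs
    rw [← this]; push_cast
    linear_combination (-(t:ℂ)^2 * d^2) * Complex.I_sq
  have hne : (((t + c)^2 + d^2 : ℝ) : ℂ) ≠ 0 := by exact_mod_cast hp.ne'
  have n1 : 1 + (t:ℂ) * (c + d * Complex.I) ≠ 0 := left_ne_zero_of_mul (hprod ▸ hne)
  have n2 : 1 + (t:ℂ) * (c - d * Complex.I) ≠ 0 := right_ne_zero_of_mul (hprod ▸ hne)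
  have n3 : -(rexp x : ℂ) - s ≠ 0 := by
    have : ((rexp x + s : ℝ) : ℂ) ≠ 0 := by exact_mod_cast hes
    intro h; apply this; rw [Complex.ofReal_add]; linear_combination -h
  have n4 : (rexp x : ℂ) + s ≠ 0 := by
    have : ((rexp x + s : ℝ) : ℂ) ≠ 0 := by exact_mod_cast hes
    intro h; apply this; rw [Complex.ofReal_add]; linear_combination h
  rw [Complex.ofReal_div, Complex.ofReal_div, ← hprod, ← sub_div, sub_sub_sub_cancel_right]
  rw [div_sub_div _ _ n2 n1]
  push_cast
  rw [show -(Complex.exp x) - (s:ℂ) = -(Complex.exp x + s) by ring, div_neg, ← neg_div]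
  rw [← mul_div_assoc]
  congr 1
  rw [← neg_div, ← mul_div_assoc]
  congr 1 <;> ring

lemma ff_left {ρ : ℝ} (hρ : ρ ∈ Set.Ioo (0:ℝ) 1) {s : ℝ} (hs : 0 < s) :
    Tendsto (ff ρ s) (comap Complex.re atBot) (𝓝 (GG ρ (Real.log s) / s)) := by
  have h1 : Tendsto Complex.exp (comap Complex.re atBot) (𝓝 0) :=
    Complex.tendsto_exp_comap_re_atBot
  have h2 : Tendsto (fun w : ℂ => Complex.exp (ρ * w)) (comap Complex.re atBot) (𝓝 0) := by
    apply h1.comp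
    rw [tendsto_comap_iff]
    have : (Complex.re ∘ fun w : ℂ => (ρ:ℂ) * w) = fun w => ρ * w.re := by ext w; simp
    rw [this]
    exact tendsto_comap.const_mul_atBot hρ.1
  have h3 : Tendsto (GG ρ) (comap Complex.re atBot) (𝓝 (0 / (1 + 0))) :=
    h2.div (h2.const_add 1) (by simp)
  have hs' : (0:ℂ) - s ≠ 0 := by simp [hs.ne']
  have h4 := (h3.sub_const (GG ρ (Real.log s))).div (h1.sub_const (s:ℂ)) hs'
  have e : (0 / (1 + 0) - GG ρ (Real.log s)) / (0 - s) = GG ρ (Real.log s) / s := by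
    rw [zero_div, zero_sub, zero_sub, neg_div_neg_eq]
  rw [e] at h4
  exact h4

lemma ff_right {ρ : ℝ} (hρ : ρ ∈ Set.Ioo (0:ℝ) 1) {s : ℝ} (hs : 0 < s) :
    Tendsto (ff ρ s) (comap Complex.re atTop) (𝓝 0) := by
  have h1 : ∀ c : ℝ, 0 < c → Tendsto (fun w : ℂ => Complex.exp (-(c * w)))
      (comap Complex.re atTop) (𝓝 0) := by
    intro c hc
    apply Complex.tendsto_exp_comap_re_atBot.comp
    rw [tendsto_comap_iff]
    have : (Complex.re ∘ fun w : ℂ => -((c:ℂ) * w)) = fun w => -(c * w.re) := by ext w; simp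
    rw [this]
    exact tendsto_neg_atTop_atBot.comp (tendsto_comap.const_mul_atTop hc)
  have h2 := h1 ρ hρ.1
  have h3 : Tendsto (GG ρ) (comap Complex.re atTop) (𝓝 (1 / (0 + 1))) := by
    have : GG ρ = fun w => 1 / (Complex.exp (-(ρ * w)) + 1) := by
      ext w
      unfold GG
      have := Complex.exp_ne_zero (ρ * w)
      rw [Complex.exp_neg]
      field_simp
    rw [this]
    exact tendsto_const_nhds.div (h2.add_const 1) (by simp)
  have h4 : Tendsto (fun w : ℂ => (Complex.exp w - s)⁻¹) (comap Complex.re atTop) (𝓝 (0 / (1 - s * 0))) := by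
    have h5 := h1 1 one_pos
    have : (fun w : ℂ => (Complex.exp w - s)⁻¹) =
        fun w => Complex.exp (-((1:ℝ) * w)) / (1 - s * Complex.exp (-((1:ℝ) * w))) := by
      ext w
      have := Complex.exp_ne_zero w
      rw [Complex.exp_neg, Complex.ofReal_one, one_mul]
      field_simp
    rw [this]
    exact h5.div ((h5.const_mul (s:ℂ)).const_sub 1) (by simp)
  have h5 := (h3.sub_const (GG ρ (Real.log s))).mul h4
  have e : ff ρ s = fun w => (GG ρ w - GG ρ (Real.log s)) * (Complex.exp w - s)⁻¹ := by
    ext w; simp [ff, div_eq_mul_inv]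
  rw [e]
  simpa using h5

lemma kk_integral {ρ : ℝ} (hρ : ρ ∈ Set.Ioo (0:ℝ) 1) {s : ℝ} (hs : 0 < s)
    (hint : Integrable (fun x => kk ρ x / (rexp x + s))) :
    ∫ x, kk ρ x / (rexp x + s) = π * (s ^ ρ / (1 + s ^ ρ) / s) := by
  have hp := Real.pi_pos
  have t1 : Tendsto (fun R : ℝ => ∫ x in (-R)..R, kk ρ x / (rexp x + s)) atTop
      (𝓝 (∫ x, kk ρ x / (rexp x + s))) :=
    intervalIntegral_tendsto_integral hint tendsto_neg_atTop_atBot tendsto_id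
  have t2 := tendsto_vert (ff_meas ρ s) (ff_right hρ hs)
  have t3 := (tendsto_vert (ff_meas ρ s) (ff_left hρ hs)).comp tendsto_neg_atTop_atBot
  have t4 : Tendsto (fun R : ℝ => 2 * Complex.I * ((∫ x in (-R)..R, kk ρ x / (rexp x + s) : ℝ) : ℂ))
      atTop (𝓝 (2 * Complex.I * ((∫ x, kk ρ x / (rexp x + s) : ℝ) : ℂ))) :=
    ((Complex.continuous_ofReal.tendsto _).comp t1).const_mul _
  have hlog : Complex.exp (ρ * Real.log s) = ((s ^ ρ : ℝ) : ℂ) := by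
    rw [Real.rpow_def_of_pos hs]; push_cast; ring_nf
  have hcont : ∀ c : ℝ, |c| ≤ π → c ≠ 0 → Continuous (fun x : ℝ => ff ρ s (x + (c:ℝ) * Complex.I)) := by
    intro c hc hc0
    unfold ff GG
    have hl : |c| < 2 * π := by linarith
    refine Continuous.div ?_ (by fun_prop) ?_
    · refine Continuous.sub ?_ continuous_const
      refine Continuous.div (by fun_prop) (by fun_prop) ?_
      intro x
      apply one_add_exp_ne
      simp only [Complex.mul_im, Complex.add_im, Complex.ofReal_im, Complex.ofReal_re,
        Complex.I_im, Complex.I_re]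
      have := hρ.1; have := hρ.2
      have h3 := abs_le.1 hc
      rw [abs_lt]
      constructor <;> nlinarith
    · intro x h
      have : (x + (c:ℝ) * Complex.I) = ((Real.log s : ℝ) : ℂ) := by
        apply exp_inj_strip
        · simpa using hl
        · rw [sub_eq_zero.1 h, ← Complex.ofReal_exp, Real.exp_log hs]
      have := congrArg Complex.im this
      simp at this
      exact hc0 this
  have ci1 := hcont (-π) (by rw [abs_neg, abs_of_pos hp]) (by linarith)
  have ci2 := hcont (π) (by rw [abs_of_pos hp]) (by linarith)
  have t5 : Tendsto (fun R : ℝ => 2 * Complex.I * ((∫ x in (-R)..R, kk ρ x / (rexp x + s) : ℝ) : ℂ))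
      atTop (𝓝 (Complex.I * (2 * π * (GG ρ (Real.log s) / s)) - Complex.I * (2 * π * 0))) := by
    refine Tendsto.congr' ?_ ((t3.const_mul Complex.I).sub (t2.const_mul Complex.I))
    filter_upwards [eventually_gt_atTop |Real.log s|] with R hR
    have := ff_rect hρ hs hR
    rw [← intervalIntegral.integral_sub (ci1.intervalIntegrable _ _) (ci2.intervalIntegrable _ _)] at this
    simp only [ff_diff hρ hs] at this
    rw [intervalIntegral.integral_const_mul, intervalIntegral.integral_ofReal] at this
    simp only [smul_eq_mul] at this
    simp only [Function.comp_apply]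
    linear_combination -this
  have := tendsto_nhds_unique t4 t5
  have h6 : ((∫ x, kk ρ x / (rexp x + s) : ℝ) : ℂ) = ((π * (s ^ ρ / (1 + s ^ ρ) / s) : ℝ) : ℂ) := by
    have hI : (2 * Complex.I) ≠ 0 := by simp
    apply mul_left_cancel₀ hI
    rw [this]
    unfold GG
    rw [hlog]
    push_cast
    ring
  exact_mod_cast h6

lemma laplace_unique {f : ℝ → ℝ} (hf : IntegrableOn f (Ioi 0))
    (h : ∀ n : ℕ, ∫ x in Ioi (0:ℝ), f x * rexp (-(n * x)) = 0) :
    ∀ᵐ x : ℝ, x ∈ Ioi (0:ℝ) → f x = 0 := by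
  have hexp : ∀ x ∈ Ioi (0:ℝ), rexp (-x) ∈ Icc (0:ℝ) 1 := fun x hx =>
    ⟨(exp_pos _).le, exp_le_one_iff.2 (by simpa using le_of_lt hx)⟩
  have hint : ∀ n : ℕ, IntegrableOn (fun x => f x * rexp (-(n * x))) (Ioi 0) := by
    intro n
    refine Integrable.mul_bdd (c := 1) hf (by fun_prop) ?_
    filter_upwards [ae_restrict_mem measurableSet_Ioi] with x hx
    rw [norm_of_nonneg (exp_pos _).le, exp_le_one_iff]
    have : (0:ℝ) < x := hx
    have : (0:ℝ) ≤ n * x := by positivity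
    linarith
  have hpe : ∀ (p : Polynomial ℝ) (x : ℝ), f x * p.eval (rexp (-x)) =
      ∑ i ∈ Finset.range (p.natDegree + 1), p.coeff i * (f x * rexp (-(i * x))) := by
    intro p x
    rw [Polynomial.eval_eq_sum_range, Finset.mul_sum]
    refine Finset.sum_congr rfl fun i _ => ?_
    rw [← Real.exp_nat_mul]; ring_nf
  have hpi : ∀ p : Polynomial ℝ, IntegrableOn (fun x => f x * p.eval (rexp (-x))) (Ioi 0) := by
    intro p
    simp only [hpe]
    exact integrable_finsetSum _ fun i _ => (hint i).const_mul _
  have hp0 : ∀ p : Polynomial ℝ, ∫ x in Ioi (0:ℝ), f x * p.eval (rexp (-x)) = 0 := by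
    intro p
    simp only [hpe]
    rw [integral_finsetSum _ fun i _ => (hint i).const_mul _]
    refine Finset.sum_eq_zero fun i _ => ?_
    rw [integral_const_mul, h, mul_zero]
  refine IsOpen.ae_eq_zero_of_integral_contDiff_smul_eq_zero isOpen_Ioi hf.locallyIntegrableOn ?_
  intro g hg hgc hgs
  have hgz : ∀ x, x ∉ Ioi (0:ℝ) → g x = 0 := fun x hx =>
    image_eq_zero_of_notMem_tsupport fun h => hx (hgs h)
  rw [← setIntegral_eq_integral_of_forall_compl_eq_zero (s := Ioi 0)
    (fun x hx => by rw [hgz x hx, zero_smul])]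
  have hgcont := hg.continuous
  have hφ : ContinuousOn (fun t => g (-Real.log t)) (Icc 0 1) := by
    intro t ht
    rcases eq_or_lt_of_le ht.1 with h0 | h0
    · subst h0
      have e0 : g (-Real.log 0) = 0 := by rw [Real.log_zero]; apply hgz; simp
      have : ContinuousWithinAt (fun t => g (-Real.log t)) (Ioi 0) 0 := by
        unfold ContinuousWithinAt
        beta_reduce
        rw [e0]
        have h1 : Tendsto (fun t : ℝ => -Real.log t) (𝓝[>] 0) atTop :=
          tendsto_neg_atBot_atTop.comp Real.tendsto_log_nhdsGT_zero
        have h2 : ∀ᶠ y in atTop, g y = 0 := by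
          have := atTop_le_cocompact (IsCompact.compl_mem_cocompact hgc)
          filter_upwards [this] with y hy using image_eq_zero_of_notMem_tsupport hy
        refine Tendsto.congr' ?_ tendsto_const_nhds
        filter_upwards [h1.eventually h2] with y hy using hy.symm
      rw [← continuousWithinAt_insert_self] at this
      refine this.mono ?_
      intro y hy
      rcases eq_or_lt_of_le hy.1 with h | h
      · left; exact h.symm
      · right; exact h
    · apply ContinuousAt.continuousWithinAt
      exact hgcont.continuousAt.comp (Real.continuousAt_log h0.ne').neg
  have hgi : IntegrableOn (fun x => g x • f x) (Ioi 0) := by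
    obtain ⟨C, hC⟩ := hgc.exists_bound_of_continuous hgcont
    exact Integrable.bdd_mul (c := C) hf hgcont.aestronglyMeasurable (Eventually.of_forall hC)
  set M := ∫ x in Ioi (0:ℝ), ‖f x‖ with hM
  have hM0 : 0 ≤ M := integral_nonneg fun _ => norm_nonneg _
  have key : ∀ ε > 0, ‖∫ x in Ioi (0:ℝ), g x • f x‖ ≤ ε * M := by
    intro ε hε
    obtain ⟨p, hp⟩ := exists_polynomial_near_of_continuousOn 0 1 _ hφ ε hε
    have e : ∫ x in Ioi (0:ℝ), g x • f x =
        ∫ x in Ioi (0:ℝ), (g x • f x - f x * p.eval (rexp (-x))) := by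
      rw [integral_sub hgi (hpi p), hp0, sub_zero]
    rw [e, hM, ← integral_const_mul]
    refine norm_integral_le_of_norm_le (hf.norm.const_mul ε) ?_
    filter_upwards [ae_restrict_mem measurableSet_Ioi] with x hx
    have := hp _ (hexp x hx)
    rw [Real.log_exp, neg_neg] at this
    rw [smul_eq_mul, mul_comm (g x), ← mul_sub, norm_mul, mul_comm]
    apply mul_le_mul_of_nonneg_right _ (norm_nonneg _)
    rw [norm_sub_rev]
    exact this.le
  have : ‖∫ x in Ioi (0:ℝ), g x • f x‖ ≤ 0 := by
    refine le_of_forall_pos_le_add fun δ hδ => ?_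
    refine (key (δ / (M + 1)) (by positivity)).trans ?_
    rw [zero_add, div_mul_eq_mul_div, div_le_iff₀ (by positivity)]
    nlinarith
  exact norm_le_zero_iff.1 this

lemma gamma_lb {T a : ℝ} (hT : 0 < T) (ha : 0 ≤ a) : T ^ a * rexp (-T) ≤ Real.Gamma (1 + a) := by
  rw [Real.Gamma_eq_integral (by linarith)]
  have hi := Real.GammaIntegral_convergent (s := 1 + a) (by linarith)
  have hTs : Ioi T ⊆ Ioi (0:ℝ) := Ioi_subset_Ioi hT.le
  calc T ^ a * rexp (-T) = ∫ x in Ioi T, T ^ a * rexp (-x) := by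
        rw [integral_const_mul, integral_exp_neg_Ioi]
    _ ≤ ∫ x in Ioi T, rexp (-x) * x ^ (1 + a - 1) := by
        refine setIntegral_mono_on ((integrableOn_exp_neg_Ioi T).const_mul _) (hi.mono_set hTs)
          measurableSet_Ioi ?_
        intro x hx
        have hx' : T < x := hx
        rw [mul_comm, add_sub_cancel_left]
        gcongr
    _ ≤ ∫ x in Ioi 0, rexp (-x) * x ^ (1 + a - 1) := by
        refine setIntegral_mono_set hi ?_ (Eventually.of_forall hTs)
        filter_upwards [ae_restrict_mem measurableSet_Ioi] with x hx
        have hx' : 0 < x := hx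
        positivity

lemma ml_term {ρ : ℝ} (hρ : ρ ∈ Set.Ioo (0:ℝ) 1) {T : ℝ} (hT : 0 < T) (z : ℝ) (k : ℕ) :
    ‖z ^ k / Real.Gamma (1 + ρ * (k : ℝ))‖ ≤ rexp T * (|z| / T ^ ρ) ^ k := by
  have hρ0 := hρ.1
  have h := gamma_lb hT (a := ρ * k) (by positivity)
  have hpos : 0 < T ^ (ρ * k) * rexp (-T) := by positivity
  rw [norm_div, norm_pow, Real.norm_eq_abs, Real.norm_of_nonneg (hpos.trans_le h).le]
  calc |z| ^ k / Real.Gamma (1 + ρ * k) ≤ |z| ^ k / (T ^ (ρ * k) * rexp (-T)) := by gcongr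
    _ = _ := by
      rw [Real.rpow_mul hT.le, Real.rpow_natCast, div_pow, Real.exp_neg]
      field_simp

lemma ml_continuous {ρ : ℝ} (hρ : ρ ∈ Set.Ioo (0:ℝ) 1) : Continuous (mittagLeffler ρ) := by
  rw [continuous_iff_continuousAt]
  intro z
  have hM : 0 < |z| + 1 := by positivity
  set T := (2 * (|z| + 1)) ^ (1 / ρ) with hTd
  have hT : 0 < T := by positivity
  have hTρ : T ^ ρ = 2 * (|z| + 1) := by
    rw [hTd, ← Real.rpow_mul (by positivity), one_div_mul_cancel hρ.1.ne', Real.rpow_one]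
  have : ContinuousOn (mittagLeffler ρ) (Metric.ball z 1) := by
    unfold mittagLeffler
    refine continuousOn_tsum (u := fun k : ℕ => rexp T * (1 / 2) ^ k) (fun k => by fun_prop)
      ((summable_geometric_of_lt_one (by norm_num) (by norm_num)).mul_left _) ?_
    intro k y hy
    refine (ml_term hρ hT y k).trans ?_
    have hy' : |y| ≤ |z| + 1 := by
      rw [Metric.mem_ball, Real.dist_eq] at hy
      have := abs_sub_abs_le_abs_sub y z
      linarith
    have hle : |y| / T ^ ρ ≤ 1 / 2 := by
      rw [hTρ, div_le_iff₀ (by positivity)]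
      linarith
    exact mul_le_mul_of_nonneg_left (pow_le_pow_left₀ (by positivity) hle k) (exp_pos _).le
  exact this.continuousAt (Metric.ball_mem_nhds z one_pos)

lemma ml_bound {ρ : ℝ} (hρ : ρ ∈ Set.Ioo (0:ℝ) 1) {x : ℝ} (hx : 0 < x) :
    ‖mittagLeffler ρ (-(x ^ ρ))‖ ≤ (1 - (1 / 2) ^ ρ)⁻¹ * rexp (2 * x) := by
  have h1 : (1 / 2 : ℝ) ^ ρ < 1 := Real.rpow_lt_one (by norm_num) (by norm_num) hρ.1
  have h0 : (0:ℝ) ≤ (1 / 2 : ℝ) ^ ρ := by positivity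
  have hs := (hasSum_geometric_of_lt_one h0 h1).mul_left (rexp (2 * x))
  rw [mul_comm]
  refine tsum_of_norm_bounded hs fun k => ?_
  refine (ml_term hρ (T := 2 * x) (by positivity) _ k).trans_eq ?_
  rw [abs_neg, abs_of_pos (by positivity), ← Real.div_rpow hx.le (by positivity)]
  congr 3
  field_simp

lemma ml_laplace {ρ : ℝ} (hρ : ρ ∈ Set.Ioo (0:ℝ) 1) {s : ℝ} (hs : 1 < s) :
    ∫ x in Ioi (0:ℝ), rexp (-(s * x)) * mittagLeffler ρ (-(x ^ ρ)) = s ^ ρ / (1 + s ^ ρ) / s := by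
  have hρ0 := hρ.1
  have hs0 : 0 < s := by linarith
  have hg : ∀ k : ℕ, 0 < Real.Gamma (1 + ρ * k) := fun k => Real.Gamma_pos_of_pos (by positivity)
  set F : ℕ → ℝ → ℝ := fun k x => rexp (-(s * x)) * ((-(x ^ ρ)) ^ k / Real.Gamma (1 + ρ * k)) with hF
  have hFe : ∀ k, ∀ x ∈ Ioi (0:ℝ), F k x =
      ((-1) ^ k / Real.Gamma (1 + ρ * k)) * (x ^ ((1 + ρ * k) - 1) * rexp (-(s * x))) := by
    intro k x hx
    have hx' : (0:ℝ) < x := hx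
    rw [hF, add_sub_cancel_left, Real.rpow_mul hx'.le, Real.rpow_natCast]
    simp only
    rw [neg_pow]; ring
  have hFn : ∀ k, ∀ x ∈ Ioi (0:ℝ), ‖F k x‖ =
      (1 / Real.Gamma (1 + ρ * k)) * (x ^ ((1 + ρ * k) - 1) * rexp (-(s * x))) := by
    intro k x hx
    have hx' : (0:ℝ) < x := hx
    rw [hFe k x hx, norm_mul, norm_div, norm_pow, norm_neg, norm_one, one_pow,
      Real.norm_of_nonneg (hg k).le, Real.norm_of_nonneg (by positivity)]
  have hI : ∀ k : ℕ, IntegrableOn (fun x : ℝ => x ^ ((1 + ρ * k) - 1) * rexp (-(s * x))) (Ioi 0) := by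
    intro k
    have h0 : (0:ℝ) ≤ ρ * k := by positivity
    have := integrableOn_rpow_mul_exp_neg_mul_rpow (p := 1) (s := (1 + ρ * k) - 1) (b := s)
      (by linarith) one_pos hs0
    simpa using this
  have hr : ∀ k : ℕ, (1 / s) ^ (1 + ρ * (k:ℝ)) = 1 / s * (((1 / s) ^ ρ) ^ k) := by
    intro k
    rw [Real.rpow_add (by positivity), Real.rpow_one, Real.rpow_mul (by positivity),
      Real.rpow_natCast]
  have hq1 : (1 / s) ^ ρ < 1 := Real.rpow_lt_one (by positivity) (by rw [div_lt_one hs0]; exact hs) hρ0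
  have hq0 : 0 < (1 / s) ^ ρ := by positivity
  have hFint : ∀ k, ∫ x in Ioi (0:ℝ), F k x = 1 / s * (-((1 / s) ^ ρ)) ^ k := by
    intro k
    rw [setIntegral_congr_fun measurableSet_Ioi (hFe k), integral_const_mul,
      Real.integral_rpow_mul_exp_neg_mul_Ioi (by positivity) hs0, hr, neg_pow ((1 / s) ^ ρ)]
    have := (hg k).ne'
    field_simp
  have hFnint : ∀ k, ∫ x in Ioi (0:ℝ), ‖F k x‖ = 1 / s * ((1 / s) ^ ρ) ^ k := by
    intro k
    rw [setIntegral_congr_fun measurableSet_Ioi (hFn k), integral_const_mul,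
      Real.integral_rpow_mul_exp_neg_mul_Ioi (by positivity) hs0, hr]
    have := (hg k).ne'
    field_simp
  have hsum := hasSum_integral_of_summable_integral_norm (μ := volume.restrict (Ioi (0:ℝ))) (F := F)
    (fun k => by
      have := (hI k).const_mul ((-1) ^ k / Real.Gamma (1 + ρ * k))
      exact IntegrableOn.congr_fun this (fun x hx => (hFe k x hx).symm) measurableSet_Ioi)
    (by
      simp only [hFnint]
      exact (summable_geometric_of_lt_one hq0.le hq1).mul_left _)
  simp only [hFint] at hsum
  have hgeo := (hasSum_geometric_of_abs_lt_one (r := -((1 / s) ^ ρ))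
    (by rw [abs_neg, abs_of_pos hq0]; exact hq1)).mul_left (1 / s)
  have := hsum.unique hgeo
  have e : ∀ x, ∑' k, F k x = rexp (-(s * x)) * mittagLeffler ρ (-(x ^ ρ)) := by
    intro x
    rw [hF, mittagLeffler, tsum_mul_left]
  simp only [e] at this
  rw [this, one_div s, Real.inv_rpow hs0.le]
  have : 0 < s ^ ρ := by positivity
  have h3 : (1 - -(s ^ ρ)⁻¹)⁻¹ = s ^ ρ / (1 + s ^ ρ) := by
    rw [inv_eq_one_div, div_eq_div_iff (by rw [sub_neg_eq_add]; positivity) (by positivity)]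
    field_simp
    ring
  rw [h3]
  ring

def KK (ρ r : ℝ) : ℝ :=
  r ^ (ρ - 1) * sin (π * ρ) / ((r ^ ρ + cos (π * ρ)) ^ 2 + sin (π * ρ) ^ 2)

lemma KK_meas (ρ : ℝ) : Measurable (KK ρ) := by unfold KK; fun_prop

lemma KK_nonneg {ρ : ℝ} (hρ : ρ ∈ Set.Ioo (0:ℝ) 1) {r : ℝ} (hr : 0 < r) : 0 ≤ KK ρ r := by
  have h1 := den_pos hρ (r ^ ρ)
  have h2 := sin_pos' hρ
  unfold KK
  positivity

lemma KK_le {ρ : ℝ} (hρ : ρ ∈ Set.Ioo (0:ℝ) 1) {r : ℝ} (hr : 0 < r) :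
    KK ρ r ≤ (1 / sin (π * ρ)) * r ^ (ρ - 1) := by
  have h1 := den_pos hρ (r ^ ρ)
  have h2 := sin_pos' hρ
  have h3 : 0 < r ^ (ρ - 1) := by positivity
  unfold KK
  rw [div_le_iff₀ h1, one_div, inv_mul_eq_div, div_mul_eq_mul_div, le_div_iff₀ h2]
  rw [mul_assoc]
  gcongr
  nlinarith [sq_nonneg (r ^ ρ + cos (π * ρ))]

lemma KK_exp {ρ : ℝ} (x : ℝ) : rexp x * KK ρ (rexp x) = kk ρ x := by
  unfold KK kk
  rw [← Real.exp_mul, ← Real.exp_mul, ← mul_div_assoc, ← mul_assoc, ← Real.exp_add]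
  ring_nf

lemma KK_exp_int {ρ : ℝ} (hρ : ρ ∈ Set.Ioo (0:ℝ) 1) {x : ℝ} (hx : 0 < x) :
    IntegrableOn (fun r => rexp (-(r * x)) * KK ρ r) (Ioi 0) := by
  have hI : IntegrableOn (fun r : ℝ => r ^ (ρ - 1) * rexp (-(x * r))) (Ioi 0) := by
    have := integrableOn_rpow_mul_exp_neg_mul_rpow (p := 1) (s := ρ - 1) (b := x)
      (by linarith [hρ.1]) one_pos hx
    simpa using this
  refine Integrable.mono' (hI.const_mul (1 / sin (π * ρ)))
    ((Measurable.mul (by fun_prop) (KK_meas ρ)).aestronglyMeasurable) ?_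
  filter_upwards [ae_restrict_mem measurableSet_Ioi] with r hr
  rw [norm_mul, Real.norm_of_nonneg (exp_pos _).le, Real.norm_of_nonneg (KK_nonneg hρ hr)]
  calc _ ≤ rexp (-(r * x)) * ((1 / sin (π * ρ)) * r ^ (ρ - 1)) := by
        gcongr; exact KK_le hρ hr
    _ = _ := by rw [mul_comm r x]; ring

lemma KK_int_le {ρ : ℝ} (hρ : ρ ∈ Set.Ioo (0:ℝ) 1) {x : ℝ} (hx : 0 < x) :
    ∫ r in Ioi (0:ℝ), rexp (-(r * x)) * KK ρ r ≤
      (1 / sin (π * ρ)) * ((1 / x) ^ ρ * Real.Gamma ρ) := by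
  have hI : IntegrableOn (fun r : ℝ => r ^ (ρ - 1) * rexp (-(x * r))) (Ioi 0) := by
    have := integrableOn_rpow_mul_exp_neg_mul_rpow (p := 1) (s := ρ - 1) (b := x)
      (by linarith [hρ.1]) one_pos hx
    simpa using this
  rw [← Real.integral_rpow_mul_exp_neg_mul_Ioi hρ.1 hx, ← integral_const_mul]
  refine setIntegral_mono_on (KK_exp_int hρ hx) (hI.const_mul _) measurableSet_Ioi fun r hr => ?_
  calc _ ≤ rexp (-(r * x)) * ((1 / sin (π * ρ)) * r ^ (ρ - 1)) := by
        gcongr; exact KK_le hρ hr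
    _ = _ := by rw [mul_comm r x]; ring

lemma prod_int {ρ : ℝ} (hρ : ρ ∈ Set.Ioo (0:ℝ) 1) {s : ℝ} (hs : 0 < s) :
    Integrable (fun p : ℝ × ℝ => rexp (-(s * p.1)) * (rexp (-(p.2 * p.1)) * KK ρ p.2))
      ((volume.restrict (Ioi 0)).prod (volume.restrict (Ioi 0))) := by
  have hm : AEStronglyMeasurable (fun p : ℝ × ℝ => rexp (-(s * p.1)) * (rexp (-(p.2 * p.1)) * KK ρ p.2))
      ((volume.restrict (Ioi 0)).prod (volume.restrict (Ioi 0))) := by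
    have := KK_meas ρ
    apply Measurable.aestronglyMeasurable
    fun_prop
  rw [integrable_prod_iff hm]
  constructor
  · filter_upwards [ae_restrict_mem measurableSet_Ioi] with x hx
    exact (KK_exp_int hρ hx).const_mul _
  · have hI : IntegrableOn (fun x : ℝ => x ^ (-ρ) * rexp (-(s * x))) (Ioi 0) := by
      have := integrableOn_rpow_mul_exp_neg_mul_rpow (p := 1) (s := -ρ) (b := s)
        (by linarith [hρ.2]) one_pos hs
      simpa using this
    refine Integrable.mono' (hI.const_mul ((1 / sin (π * ρ)) * Real.Gamma ρ))
      hm.norm.integral_prod_right' ?_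
    filter_upwards [ae_restrict_mem measurableSet_Ioi] with x hx
    have hx' : (0:ℝ) < x := hx
    rw [Real.norm_of_nonneg (integral_nonneg fun _ => norm_nonneg _)]
    have e : ∫ r in Ioi (0:ℝ), ‖rexp (-(s * x)) * (rexp (-(r * x)) * KK ρ r)‖ =
        rexp (-(s * x)) * ∫ r in Ioi (0:ℝ), rexp (-(r * x)) * KK ρ r := by
      rw [← integral_const_mul]
      refine setIntegral_congr_fun measurableSet_Ioi fun r hr => ?_
      have := KK_nonneg hρ hr
      exact Real.norm_of_nonneg (by positivity)
    simp only [e]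
    calc _ ≤ rexp (-(s * x)) * ((1 / sin (π * ρ)) * ((1 / x) ^ ρ * Real.Gamma ρ)) := by
          gcongr; exact KK_int_le hρ hx
      _ = _ := by
        rw [one_div x, Real.inv_rpow hx'.le, Real.rpow_neg hx'.le]; ring

lemma inner_int {ρ : ℝ} {s r : ℝ} (hs : 0 < s) (hr : 0 < r) :
    ∫ x in Ioi (0:ℝ), rexp (-(s * x)) * (rexp (-(r * x)) * KK ρ r) = KK ρ r / (r + s) := by
  have e : ∀ x : ℝ, rexp (-(s * x)) * (rexp (-(r * x)) * KK ρ r) =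
      rexp (-(r + s) * x) * KK ρ r := by
    intro x
    rw [← mul_assoc, ← Real.exp_add]; ring_nf
  simp only [e]
  rw [integral_mul_const, integral_exp_mul_Ioi (by linarith)]
  have : r + s ≠ 0 := by positivity
  rw [mul_zero, Real.exp_zero, neg_div_neg_eq]
  ring

lemma v_laplace {ρ : ℝ} (hρ : ρ ∈ Set.Ioo (0:ℝ) 1) {s : ℝ} (hs : 0 < s) :
    IntegrableOn (fun x => rexp (-(s * x)) * ∫ r in Ioi (0:ℝ), rexp (-(r * x)) * KK ρ r) (Ioi 0) ∧
    ∫ x in Ioi (0:ℝ), rexp (-(s * x)) * ∫ r in Ioi (0:ℝ), rexp (-(r * x)) * KK ρ r =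
      π * (s ^ ρ / (1 + s ^ ρ) / s) := by
  have hP := prod_int hρ hs
  have h1 := hP.integral_prod_left
  have h2 := hP.integral_prod_right
  have h3 := integral_integral_swap
    (f := fun x r => rexp (-(s * x)) * (rexp (-(r * x)) * KK ρ r)) hP
  simp only [integral_const_mul] at h1 h3
  refine ⟨h1, ?_⟩
  rw [h3, setIntegral_congr_fun measurableSet_Ioi (fun r hr => inner_int hs hr)]
  have h4 : IntegrableOn (fun r => KK ρ r / (r + s)) (Ioi 0) :=
    IntegrableOn.congr_fun h2 (fun r hr => inner_int hs hr) measurableSet_Ioi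
  have hr : rexp '' univ = Ioi 0 := by rw [image_univ, Real.range_exp]
  have hd : ∀ x ∈ (univ : Set ℝ), HasDerivWithinAt rexp (rexp x) univ x :=
    fun x _ => (Real.hasDerivAt_exp x).hasDerivWithinAt
  have e : ∀ x : ℝ, |rexp x| • (KK ρ (rexp x) / (rexp x + s)) = kk ρ x / (rexp x + s) := by
    intro x
    rw [abs_of_pos (exp_pos _), smul_eq_mul, ← mul_div_assoc, KK_exp]
  rw [← hr] at h4 ⊢
  rw [integral_image_eq_integral_abs_deriv_smul MeasurableSet.univ hd Real.exp_injective.injOn]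
  rw [integrableOn_image_iff_integrableOn_abs_deriv_smul MeasurableSet.univ hd
    Real.exp_injective.injOn] at h4
  simp only [e] at h4 ⊢
  rw [integrableOn_univ] at h4
  rw [setIntegral_univ]
  exact kk_integral hρ hs h4

def muK (ρ : ℝ) : Measure ℝ := (volume.restrict (Ioi 0)).withDensity (fun r => ENNReal.ofReal (KK ρ r))

lemma mgf_eq {ρ : ℝ} (hρ : ρ ∈ Set.Ioo (0:ℝ) 1) (x : ℝ) :
    ProbabilityTheory.mgf (fun r : ℝ => -r) (muK ρ) x = ∫ r in Ioi (0:ℝ), rexp (-(r * x)) * KK ρ r := by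
  unfold ProbabilityTheory.mgf muK
  rw [integral_withDensity_eq_integral_toReal_smul (KK_meas ρ).ennreal_ofReal
    (Eventually.of_forall fun _ => ENNReal.ofReal_lt_top)]
  refine setIntegral_congr_fun measurableSet_Ioi fun r hr => ?_
  simp only [smul_eq_mul]
  rw [ENNReal.toReal_ofReal (KK_nonneg hρ hr), mul_comm]
  ring_nf

lemma mgf_dom {ρ : ℝ} (hρ : ρ ∈ Set.Ioo (0:ℝ) 1) :
    Ioi 0 ⊆ interior (ProbabilityTheory.integrableExpSet (fun r : ℝ => -r) (muK ρ)) := by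
  apply interior_maximal _ isOpen_Ioi
  intro x hx
  show Integrable _ _
  unfold muK
  rw [integrable_withDensity_iff_integrable_smul' (KK_meas ρ).ennreal_ofReal
    (Eventually.of_forall fun _ => ENNReal.ofReal_lt_top)]
  refine IntegrableOn.congr_fun (KK_exp_int hρ hx) (fun r hr => ?_) measurableSet_Ioi
  simp only [smul_eq_mul]
  rw [ENNReal.toReal_ofReal (KK_nonneg hρ hr), mul_comm]
  ring_nf

lemma main_eq {ρ : ℝ} (hρ : ρ ∈ Set.Ioo (0:ℝ) 1) {x : ℝ} (hx : 0 < x) :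
    mittagLeffler ρ (-(x ^ ρ)) = (1 / π) * ProbabilityTheory.mgf (fun r : ℝ => -r) (muK ρ) x := by
  set u : ℝ → ℝ := fun x => mittagLeffler ρ (-(x ^ ρ)) with hu
  set v : ℝ → ℝ := fun x => (1 / π) * ProbabilityTheory.mgf (fun r : ℝ => -r) (muK ρ) x with hv
  have huc : ContinuousOn u (Ioi 0) := by
    refine (ml_continuous hρ).comp_continuousOn ?_
    exact (continuousOn_id.rpow_const fun y hy => Or.inl (ne_of_gt hy)).neg
  have hvc : ContinuousOn v (Ioi 0) :=
    continuousOn_const.mul (ProbabilityTheory.continuousOn_mgf.mono (mgf_dom hρ))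
  have hui : ∀ s : ℝ, 2 < s → IntegrableOn (fun x => rexp (-(s * x)) * u x) (Ioi 0) := by
    intro s hs
    have hI : IntegrableOn (fun x => (1 - (1 / 2) ^ ρ)⁻¹ * rexp (-(s - 2) * x)) (Ioi 0) :=
      (integrableOn_exp_mul_Ioi (by linarith) 0).const_mul _
    refine Integrable.mono' hI ?_ ?_
    · exact ContinuousOn.aestronglyMeasurable (by fun_prop) measurableSet_Ioi
    · filter_upwards [ae_restrict_mem measurableSet_Ioi] with y hy
      rw [norm_mul, Real.norm_of_nonneg (exp_pos _).le]
      calc _ ≤ rexp (-(s * y)) * ((1 - (1 / 2) ^ ρ)⁻¹ * rexp (2 * y)) := by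
            gcongr; exact ml_bound hρ hy
        _ = _ := by
          rw [mul_left_comm, ← Real.exp_add]; ring_nf
  have hvi : ∀ s : ℝ, 0 < s → IntegrableOn (fun x => rexp (-(s * x)) * v x) (Ioi 0) ∧
      ∫ x in Ioi (0:ℝ), rexp (-(s * x)) * v x = s ^ ρ / (1 + s ^ ρ) / s := by
    intro s hs
    obtain ⟨h1, h2⟩ := v_laplace hρ hs
    have e : ∀ x, rexp (-(s * x)) * v x =
        (1 / π) * (rexp (-(s * x)) * ∫ r in Ioi (0:ℝ), rexp (-(r * x)) * KK ρ r) := by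
      intro x
      rw [hv]; simp only [mgf_eq hρ]; ring
    simp only [e]
    refine ⟨h1.const_mul _, ?_⟩
    rw [integral_const_mul, h2]
    have := Real.pi_ne_zero
    field_simp
  have hae := laplace_unique (f := fun x => rexp (-(3 * x)) * u x - rexp (-(3 * x)) * v x)
    ((hui 3 (by norm_num)).sub (hvi 3 (by norm_num)).1) (by
      intro n
      have hn : (0:ℝ) ≤ n := by positivity
      have e : ∀ x : ℝ, (rexp (-(3 * x)) * u x - rexp (-(3 * x)) * v x) * rexp (-(n * x)) =
          rexp (-((3 + n) * x)) * u x - rexp (-((3 + n) * x)) * v x := by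
        intro x
        rw [show -((3 + (n:ℝ)) * x) = -(3 * x) + -(n * x) by ring, Real.exp_add]; ring
      simp only [e]
      rw [integral_sub (hui _ (by linarith)) (hvi _ (by linarith)).1, (hvi _ (by linarith)).2,
        ml_laplace hρ (by linarith), sub_self])
  have hae2 : u =ᵐ[volume.restrict (Ioi 0)] v := by
    rw [EventuallyEq, ae_restrict_iff' measurableSet_Ioi]
    filter_upwards [hae] with y hy hy0
    have := hy hy0
    rw [← mul_sub] at this
    have := (mul_eq_zero.1 this).resolve_left (exp_pos _).ne'
    linarith
  exact Measure.eqOn_open_of_ae_eq hae2 isOpen_Ioi huc hvc hx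

lemma cm_of_mgf {μ : Measure ℝ} {X : ℝ → ℝ} (hX : ∀ᵐ r ∂μ, X r ≤ 0)
    (hI : Ioi 0 ⊆ interior (ProbabilityTheory.integrableExpSet X μ)) {g : ℝ → ℝ} {c : ℝ}
    (hc : 0 ≤ c) (hg : ∀ x, 0 < x → g x = c * ProbabilityTheory.mgf X μ x) :
    CompletelyMonotoneOn g ∧ CompletelyMonotoneOn (fun x => -deriv g x) := by
  have ev : ∀ x, 0 < x → g =ᶠ[𝓝 x] fun x => c * ProbabilityTheory.mgf X μ x := by
    intro x hx
    filter_upwards [isOpen_Ioi.mem_nhds hx] with y hy using hg y hy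
  have h1 : ∀ n x, 0 < x → iteratedDeriv n g x =
      c * iteratedDeriv n (ProbabilityTheory.mgf X μ) x := by
    intro n x hx
    rw [(ev x hx).iteratedDeriv_eq, iteratedDeriv_const_mul_field]
  have hd : ∀ n, DifferentiableOn ℝ (iteratedDeriv n g) (Set.Ioi 0) := by
    intro n
    refine DifferentiableOn.congr (f := fun x => c * iteratedDeriv n (ProbabilityTheory.mgf X μ) x) ?_
      (fun x hx => h1 n x hx)
    intro x hx
    exact ((ProbabilityTheory.differentiableAt_iteratedDeriv_mgf (hI hx) n).const_mul
      c).differentiableWithinAt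
  have hp : ∀ n : ℕ, ∀ s : ℝ, 0 < s → 0 ≤ (-1 : ℝ) ^ n * iteratedDeriv n g s := by
    intro n s hs
    rw [h1 n s hs, ProbabilityTheory.iteratedDeriv_mgf (hI hs), mul_left_comm, ← integral_const_mul]
    refine mul_nonneg hc (integral_nonneg_of_ae ?_)
    filter_upwards [hX] with r hr
    have : (-1) ^ n * (X r ^ n * rexp (s * X r)) = (-X r) ^ n * rexp (s * X r) := by
      rw [neg_pow (X r)]; ring
    simp only [Pi.zero_apply]
    rw [this]
    have : 0 ≤ -X r := by linarith
    positivity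
  have h2 : ∀ n, iteratedDeriv n (fun x => -deriv g x) = fun x => -iteratedDeriv (n + 1) g x := by
    intro n
    ext x
    rw [iteratedDeriv_succ', ← iteratedDeriv_neg]
    rfl
  refine ⟨⟨hd, hp⟩, ?_, ?_⟩
  · intro n
    rw [h2]
    exact (hd (n + 1)).neg
  · intro n s hs
    rw [h2]
    have := hp (n + 1) s hs
    rw [pow_succ] at this
    linarith

theorem mittagLeffler_integral_representation
    (ρ : ℝ) (hρ : ρ ∈ Set.Ioo (0:ℝ) 1) :
    -- E_ρ(−x^ρ) = (1/π) ∫₀^∞ e^{−rx} r^{ρ−1} sin(πρ) / ((r^ρ + cos πρ)² + (sin πρ)²) dr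
    (∀ x : ℝ, 0 < x →
      mittagLeffler ρ (-(x ^ ρ)) =
        (1 / Real.pi) * ∫ r in Set.Ioi (0:ℝ),
          Real.exp (-(r * x)) * r ^ (ρ - 1) * Real.sin (Real.pi * ρ) /
            ((r ^ ρ + Real.cos (Real.pi * ρ)) ^ 2 + (Real.sin (Real.pi * ρ)) ^ 2)) ∧
    -- consequently x ↦ E_ρ(−x^ρ) is completely monotone on (0,∞)
    CompletelyMonotoneOn (fun x => mittagLeffler ρ (-(x ^ ρ))) ∧
    -- and so is the Mittag-Leffler density n_ρ(x) = −∂_x E_ρ(−x^ρ)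
    CompletelyMonotoneOn (fun x => -deriv (fun y => mittagLeffler ρ (-(y ^ ρ))) x) := by
  refine ⟨?_, ?_⟩
  · intro x hx
    rw [main_eq hρ hx, mgf_eq hρ]
    congr 1
    refine setIntegral_congr_fun measurableSet_Ioi fun r _ => ?_
    simp only [KK]
    ring
  · refine cm_of_mgf (μ := muK ρ) (X := fun r => -r) ?_ (mgf_dom hρ) (c := 1 / π)
      (by have := Real.pi_pos; positivity) (fun x hx => main_eq hρ hx)
    apply (withDensity_absolutelyContinuous _ _).ae_le
    filter_upwards [ae_restrict_mem measurableSet_Ioi] with r hr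
    have : (0:ℝ) < r := hr
    linarith
end
end
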